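/- Let 𝔞 be a finite-dimensional Lie algebra over a field F of prime characteristic and let S be a simple U(𝔞)-module. Then the injective dimension of S over U(𝔞) equals dim_F 𝔞. -/

import Mathlib

open CategoryTheory

universe u

/-- The `n`-th Ext group over the `F`-algebra `R`, as a functor value on modules. -/
noncomputable def ExtGrp (F : Type u) [Field F] (R : Type u) [Ring R] [Algebra F R]
    (X M : ModuleCat.{u} R) (n : ℕ) : ModuleCat F :=
  ((Ext F (ModuleCat.{u} R) n).obj (Opposite.op X)).obj M

/-- `M` has injective dimension exactly `d`: all Ext groups `Ext^n(-, M)` vanish for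
`n > d`, and `Ext^d(X, M) ≠ 0` for some `X`. -/
def InjDimEq (F : Type u) [Field F] (R : Type u) [Ring R] [Algebra F R]
    (M : ModuleCat.{u} R) (d : ℕ) : Prop :=
  (∀ (X : ModuleCat.{u} R) (n : ℕ), d < n → Subsingleton (ExtGrp F R X M n)) ∧
  ∃ X : ModuleCat.{u} R, Nontrivial (ExtGrp F R X M d)

theorem extGrp_subsingleton_iff (F : Type u) [Field F] (R : Type u) [Ring R] [Algebra F R]
    (X M : ModuleCat.{u} R) (n : ℕ) :
    Subsingleton (ExtGrp F R X M (n + 1)) ↔ Subsingleton (Abelian.Ext X M (n + 1)) := by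
  let P := ProjectiveResolution.of X
  rw [← ModuleCat.isZero_iff_subsingleton]
  have e := P.isoExt (R := F) (n + 1) M
  unfold ExtGrp
  rw [e.isZero_iff, ← HomologicalComplex.exactAt_iff_isZero_homology,
    HomologicalComplex.exactAt_iff' _ n (n + 1) (n + 1 + 1) (by simp) (by simp)]
  rw [ShortComplex.moduleCat_exact_iff]
  constructor
  · intro h
    refine subsingleton_of_forall_eq 0 fun e => ?_
    obtain ⟨f, hf, rfl⟩ := P.extMk_surjective e (n + 1 + 1) rfl
    rw [P.extMk_eq_zero_iff f _ rfl hf n rfl]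
    obtain ⟨g, hg⟩ := h f hf
    exact ⟨g, hg⟩
  · intro h f hf
    exact (P.extMk_eq_zero_iff f _ rfl hf n rfl).1 (Subsingleton.elim _ _)

theorem extGrp_zero_nontrivial (F : Type u) [Field F] (R : Type u) [Ring R] [Algebra F R]
    (X M : ModuleCat.{u} R) (g : X ⟶ M) (hg : g ≠ 0) :
    Nontrivial (ExtGrp F R X M 0) := by
  by_contra hn
  rw [not_nontrivial_iff_subsingleton, ← ModuleCat.isZero_iff_subsingleton] at hn
  let P := ProjectiveResolution.of X
  have e := P.isoExt (R := F) 0 M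
  unfold ExtGrp at hn
  rw [e.isZero_iff, ← HomologicalComplex.exactAt_iff_isZero_homology,
    HomologicalComplex.exactAt_iff' _ 0 0 1 (by simp) (by simp)] at hn
  rw [ShortComplex.moduleCat_exact_iff] at hn
  obtain ⟨(a : P.complex.X 0 ⟶ M), ha⟩ := hn ((P.π.f 0 ≫ (HomologicalComplex.singleObjXSelf _ _ _).hom ≫ g :
    P.complex.X 0 ⟶ M)) (by
      change P.complex.d 1 0 ≫ _ = 0
      rw [← Category.assoc, P.complex_d_comp_π_f_zero, Limits.zero_comp])
  have ha' : P.complex.d 0 0 ≫ a = P.π.f 0 ≫ (HomologicalComplex.singleObjXSelf _ _ _).hom ≫ g :=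
    ha
  rw [P.complex.shape _ _ (by simp), Limits.zero_comp] at ha'
  apply hg
  rw [← cancel_epi (HomologicalComplex.singleObjXSelf (ComplexShape.down ℕ) 0 X).hom,
    ← cancel_epi (P.π.f 0), ← ha',
    Limits.comp_zero, Limits.comp_zero]

theorem extGrp_nontrivial (F : Type u) [Field F] (R : Type u) [Ring R] [Algebra F R]
    (X M : ModuleCat.{u} R) (n : ℕ) (h : Nontrivial (Abelian.Ext X M n)) :
    Nontrivial (ExtGrp F R X M n) := by
  rcases n with _ | n
  · obtain ⟨e, he⟩ := exists_ne (0 : Abelian.Ext X M 0)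
    refine extGrp_zero_nontrivial F R X M (Abelian.Ext.addEquiv₀ e) ?_
    simpa using he
  · rw [← not_subsingleton_iff_nontrivial] at h ⊢
    rwa [extGrp_subsingleton_iff]



namespace PBW

variable {F : Type*} [CommRing F] {L : Type*} [LieRing L] [LieAlgebra F L] {n : ℕ}

/-- The polynomial-type module on the multisets. -/
abbrev V (F : Type*) [CommRing F] (n : ℕ) := Multiset (Fin n) →₀ F

/-- monomial -/
noncomputable abbrev z (F : Type*) [CommRing F] {n : ℕ} (M : Multiset (Fin n)) : V F n :=
  Finsupp.single M 1

/-- Linear operators from values on a basis. -/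
noncomputable def T (b : Module.Basis (Fin n) F L) (g : Fin n → Multiset (Fin n) → V F n) :
    L →ₗ[F] V F n →ₗ[F] V F n :=
  b.constr F (fun i => Finsupp.linearCombination F (g i))

theorem T_apply (b : Module.Basis (Fin n) F L) (g : Fin n → Multiset (Fin n) → V F n) (i : Fin n)
    (M : Multiset (Fin n)) : T b g (b i) (z F M) = g i M := by
  simp [T]

open Classical in
/-- recursion step -/
noncomputable def stepFn (b : Module.Basis (Fin n) F L) (d : ℕ) (A : L →ₗ[F] V F n →ₗ[F] V F n)
    (i : Fin n) (M : Multiset (Fin n)) : V F n :=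
  if M.card ≤ d then A (b i) (z F M) else
  if h : ∃ j, j ∈ M ∧ (∀ k ∈ M, j ≤ k) ∧ j < i then
    z F (i ::ₘ M) + A (b h.choose) (A (b i) (z F (M.erase h.choose)) - z F (i ::ₘ M.erase h.choose))
      + A ⁅b i, b h.choose⁆ (z F (M.erase h.choose))
  else z F (i ::ₘ M)

/-- approximate actions -/
noncomputable def act (b : Module.Basis (Fin n) F L) : ℕ → (L →ₗ[F] V F n →ₗ[F] V F n)
  | 0 => T b (fun i M => z F (i ::ₘ M))
  | d + 1 => T b (stepFn b d (act b d))

/-- the action -/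
noncomputable def rho (b : Module.Basis (Fin n) F L) : L →ₗ[F] V F n →ₗ[F] V F n :=
  T b (fun i M => act b M.card (b i) (z F M))

/-- filtration -/
noncomputable def Vle (F : Type*) [CommRing F] (n d : ℕ) : Submodule F (V F n) :=
  Submodule.span F (z F '' {M | M.card ≤ d})

theorem z_mem_Vle {d : ℕ} {M : Multiset (Fin n)} (h : M.card ≤ d) : z F M ∈ Vle F n d :=
  Submodule.subset_span ⟨M, h, rfl⟩

theorem Vle_mono {d e : ℕ} (h : d ≤ e) : Vle F n d ≤ Vle F n e :=
  Submodule.span_mono (Set.image_mono fun _ hM => le_trans hM h)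

theorem exists_mem_Vle (v : V F n) : ∃ d, v ∈ Vle F n d := by
  induction v using Finsupp.induction_linear with
  | zero => exact ⟨0, zero_mem _⟩
  | add f g hf hg =>
    obtain ⟨d, hd⟩ := hf
    obtain ⟨e, he⟩ := hg
    exact ⟨max d e, add_mem (Vle_mono (le_max_left _ _) hd) (Vle_mono (le_max_right _ _) he)⟩
  | single M c =>
    refine ⟨M.card, ?_⟩
    have : Finsupp.single M c = c • z F M := by simp [z]
    rw [this]
    exact Submodule.smul_mem _ _ (z_mem_Vle le_rfl)

theorem Vle_ext {W : Type*} [AddCommGroup W] [Module F W] {d : ℕ} {f g : V F n →ₗ[F] W}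
    (h : ∀ M : Multiset (Fin n), M.card ≤ d → f (z F M) = g (z F M)) {v : V F n}
    (hv : v ∈ Vle F n d) : f v = g v := by
  have : Set.EqOn f g (z F '' {M | M.card ≤ d}) := by
    rintro _ ⟨M, hM, rfl⟩
    exact h M hM
  exact LinearMap.eqOn_span this hv

theorem Vle_map {d e : ℕ} {f : V F n →ₗ[F] V F n}
    (h : ∀ M : Multiset (Fin n), M.card ≤ d → f (z F M) ∈ Vle F n e) {v : V F n}
    (hv : v ∈ Vle F n d) : f v ∈ Vle F n e := by
  have : Vle F n d ≤ (Vle F n e).comap f := by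
    refine Submodule.span_le.2 ?_
    rintro _ ⟨M, hM, rfl⟩
    exact h M hM
  exact this hv

variable (b : Module.Basis (Fin n) F L)

theorem act_succ_eq {d : ℕ} (x : L) {M : Multiset (Fin n)} (h : M.card ≤ d) :
    act b (d + 1) x (z F M) = act b d x (z F M) := by
  have : (act b (d + 1)).flip (z F M) = (act b d).flip (z F M) := by
    refine b.ext fun i => ?_
    simp only [LinearMap.flip_apply, act]
    rw [T_apply, stepFn, if_pos h]
  exact LinearMap.congr_fun this x

theorem act_eq_rho_z {d : ℕ} (x : L) {M : Multiset (Fin n)} (h : M.card ≤ d) :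
    act b d x (z F M) = rho b x (z F M) := by
  have h1 : act b d x (z F M) = act b M.card x (z F M) := by
    induction d, h using Nat.le_induction with
    | base => rfl
    | succ d hd ih => rw [act_succ_eq b x hd, ih]
  rw [h1]
  have : (act b M.card).flip (z F M) = (rho b).flip (z F M) := by
    refine b.ext fun i => ?_
    simp only [LinearMap.flip_apply, rho]
    rw [T_apply]
  exact LinearMap.congr_fun this x

theorem act_eq_rho {d : ℕ} (x : L) {v : V F n} (hv : v ∈ Vle F n d) :
    act b d x v = rho b x v :=
  Vle_ext (fun _ hM => act_eq_rho_z b x hM) hv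

theorem rho_of_le (i : Fin n) (M : Multiset (Fin n)) (h : ∀ j ∈ M, i ≤ j) :
    rho b (b i) (z F M) = z F (i ::ₘ M) := by
  rw [← act_eq_rho_z b _ le_rfl]
  rcases hc : M.card with _ | d
  · simp only [act]; rw [T_apply]
  · simp only [act]
    rw [T_apply, stepFn, if_neg (by omega), dif_neg]
    rintro ⟨j, hj, -, hji⟩
    exact absurd (h j hj) (not_le.2 hji)

theorem rho_mem_aux (d : ℕ)
    (hP : ∀ (i : Fin n) (N : Multiset (Fin n)), N.card ≤ d →
      rho b (b i) (z F N) - z F (i ::ₘ N) ∈ Vle F n N.card) (x : L) {v : V F n} {e : ℕ}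
    (he : e ≤ d)
    (hv : v ∈ Vle F n e) : rho b x v ∈ Vle F n (e + 1) := by
  refine Vle_map (fun M hM => ?_) hv
  have : ∀ x : L, x ∈ (Vle F n (e + 1)).comap ((rho b).flip (z F M)) := by
    intro x
    have h1 : Submodule.span F (Set.range b) ≤ (Vle F n (e + 1)).comap ((rho b).flip (z F M)) := by
      refine Submodule.span_le.2 ?_
      rintro _ ⟨i, rfl⟩
      simp only [Submodule.comap_coe, Set.mem_preimage, LinearMap.flip_apply, SetLike.mem_coe]
      rw [← sub_add_cancel (rho b (b i) (z F M)) (z F (i ::ₘ M))]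
      refine add_mem (Vle_mono (by omega) (hP i M (hM.trans he))) (z_mem_Vle ?_)
      rw [Multiset.card_cons]; omega
    rw [b.span_eq] at h1
    exact h1 trivial
  exact this x

theorem rho_rec_aux (d : ℕ)
    (hP : ∀ (i : Fin n) (N : Multiset (Fin n)), N.card ≤ d →
      rho b (b i) (z F N) - z F (i ::ₘ N) ∈ Vle F n N.card) (i j : Fin n) (N : Multiset (Fin n))
    (hN : N.card = d) (hj : ∀ k ∈ N, j ≤ k) (hji : j < i) :
    rho b (b i) (z F (j ::ₘ N)) = z F (i ::ₘ j ::ₘ N) +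
      rho b (b j) (rho b (b i) (z F N) - z F (i ::ₘ N)) + rho b ⁅b i, b j⁆ (z F N) := by
  rw [← act_eq_rho_z b _ le_rfl, Multiset.card_cons, hN]
  simp only [act]
  rw [T_apply, stepFn, if_neg (by rw [Multiset.card_cons]; omega)]
  have h : ∃ j', j' ∈ j ::ₘ N ∧ (∀ k ∈ j ::ₘ N, j' ≤ k) ∧ j' < i := by
    refine ⟨j, by simp, ?_, hji⟩
    intro k hk
    rcases Multiset.mem_cons.1 hk with rfl | hk
    · exact le_rfl
    · exact hj k hk
  rw [dif_pos h]
  have hc : h.choose = j := by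
    obtain ⟨h1, h2, -⟩ := h.choose_spec
    apply le_antisymm
    · exact h2 j (by simp)
    · rcases Multiset.mem_cons.1 h1 with h3 | h3
      · exact h3.ge
      · exact hj _ h3
  rw [hc, Multiset.erase_cons_head]
  rw [act_eq_rho_z b _ hN.le, act_eq_rho_z b _ hN.le, act_eq_rho b]
  have := hP i N hN.le
  rwa [hN] at this

theorem exists_min (M : Multiset (Fin n)) (h : M ≠ 0) :
    ∃ j N, M = j ::ₘ N ∧ ∀ k ∈ N, j ≤ k := by
  have hne : M.toFinset.Nonempty := by
    rw [Finset.nonempty_iff_ne_empty]; simpa using h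
  refine ⟨M.toFinset.min' hne, M.erase (M.toFinset.min' hne), ?_, ?_⟩
  · rw [Multiset.cons_erase]
    exact Multiset.mem_toFinset.1 (Finset.min'_mem _ _)
  · intro k hk
    exact Finset.min'_le _ _ (Multiset.mem_toFinset.2 (Multiset.mem_of_mem_erase hk))

theorem rho_lead_aux (d : ℕ) : ∀ (i : Fin n) (N : Multiset (Fin n)), N.card ≤ d →
      rho b (b i) (z F N) - z F (i ::ₘ N) ∈ Vle F n N.card := by
  induction d with
  | zero =>
    intro i N hN
    rw [rho_of_le b i N, sub_self]
    · exact zero_mem _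
    · have : N = 0 := by simpa using hN
      simp [this]
  | succ d ih =>
    intro i M hM
    rcases hM.lt_or_eq with hM | hM
    · exact ih i M (by omega)
    obtain ⟨j, N, rfl, hj⟩ := exists_min M (by rintro rfl; simp at hM)
    have hN : N.card = d := by simpa using hM
    by_cases hij : i ≤ j
    · rw [rho_of_le b i _, sub_self]
      · exact zero_mem _
      · intro k hk
        rcases Multiset.mem_cons.1 hk with rfl | hk
        · exact hij
        · exact hij.trans (hj k hk)
    · rw [rho_rec_aux b d ih i j N hN hj (not_le.1 hij), add_assoc, add_sub_cancel_left]
      have hc : (j ::ₘ N).card = N.card + 1 := by simp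
      rw [hc]
      refine add_mem (rho_mem_aux b d ih _ hN.le (ih i N hN.le))
        (rho_mem_aux b d ih _ hN.le (z_mem_Vle le_rfl))

theorem rho_lead (i : Fin n) (N : Multiset (Fin n)) :
      rho b (b i) (z F N) - z F (i ::ₘ N) ∈ Vle F n N.card :=
  rho_lead_aux b _ i N le_rfl

theorem rho_rec (i j : Fin n) (N : Multiset (Fin n)) (hj : ∀ k ∈ N, j ≤ k) (hji : j < i) :
    rho b (b i) (rho b (b j) (z F N)) =
      rho b (b j) (rho b (b i) (z F N)) + rho b ⁅b i, b j⁆ (z F N) := by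
  rw [rho_of_le b j N hj, rho_rec_aux b N.card (rho_lead_aux b _) i j N rfl hj hji, map_sub,
    rho_of_le b j (i ::ₘ N), Multiset.cons_swap]
  · abel
  · intro k hk
    rcases Multiset.mem_cons.1 hk with rfl | hk
    · exact hji.le
    · exact hj k hk

/-- Lie relation on degree at most d. -/
theorem rho_lie_aux (d : ℕ) : ∀ (x y : L) (v : V F n), v ∈ Vle F n d →
    rho b ⁅x, y⁆ v = rho b x (rho b y v) - rho b y (rho b x v) := by
  induction d using Nat.strong_induction_on with
  | _ d ih =>
  -- reduction to basis
  suffices H : ∀ (i j : Fin n), j < i → ∀ M : Multiset (Fin n), M.card ≤ d →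
      rho b ⁅b i, b j⁆ (z F M) = rho b (b i) (rho b (b j) (z F M)) -
        rho b (b j) (rho b (b i) (z F M)) by
    have H' : ∀ (i j : Fin n), ∀ M : Multiset (Fin n), M.card ≤ d →
      rho b ⁅b i, b j⁆ (z F M) = rho b (b i) (rho b (b j) (z F M)) -
        rho b (b j) (rho b (b i) (z F M)) := by
      intro i j M hM
      rcases lt_trichotomy i j with h | rfl | h
      · rw [← lie_skew, map_neg, LinearMap.neg_apply, H j i h M hM]; abel
      · simp
      · exact H i j h M hM
    intro x y v hv
    have H1 : ∀ (i : Fin n) (y : L), ∀ M : Multiset (Fin n), M.card ≤ d →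
        rho b ⁅b i, y⁆ (z F M) = rho b (b i) (rho b y (z F M)) -
          rho b y (rho b (b i) (z F M)) := by
      intro i y M hM
      induction b.mem_span y using Submodule.span_induction with
      | mem y hy => obtain ⟨j, rfl⟩ := hy; exact H' i j M hM
      | zero => simp
      | add y y' _ _ h h' => simp only [lie_add, map_add, LinearMap.add_apply, h, h']; abel
      | smul c y _ h => simp only [lie_smul, map_smul, LinearMap.smul_apply, h, smul_sub]
    have H2 : ∀ (x y : L), ∀ M : Multiset (Fin n), M.card ≤ d →
        rho b ⁅x, y⁆ (z F M) = rho b x (rho b y (z F M)) -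
          rho b y (rho b x (z F M)) := by
      intro x y M hM
      induction b.mem_span x using Submodule.span_induction with
      | mem x hx => obtain ⟨j, rfl⟩ := hx; exact H1 j y M hM
      | zero => simp
      | add y y' _ _ h h' => simp only [add_lie, map_add, LinearMap.add_apply, h, h']; abel
      | smul c y _ h => simp only [smul_lie, map_smul, LinearMap.smul_apply, h, smul_sub]
    exact Vle_ext (f := rho b ⁅x, y⁆) (g := rho b x ∘ₗ rho b y - rho b y ∘ₗ rho b x)
      (fun M hM => by simpa using H2 x y M hM) hv
  intro i j hji M hM
  by_cases hjM : ∀ k ∈ M, j ≤ k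
  · rw [rho_rec b i j M hjM hji]; abel
  obtain ⟨k, P, rfl, hk⟩ := exists_min M (by rintro rfl; simp at hjM)
  have hkj : k < j := by
    by_contra hc
    apply hjM
    intro l hl
    rcases Multiset.mem_cons.1 hl with rfl | hl
    · exact not_lt.1 hc
    · exact (not_lt.1 hc).trans (hk l hl)
  have hPd : P.card < d := by
    rw [Multiset.card_cons] at hM; omega
  have ihP := fun x y => ih P.card hPd x y (z F P) (z_mem_Vle le_rfl)
  rw [← rho_of_le b k P hk]
  have key : ∀ i j : Fin n, k < i → k < j → rho b (b i) (rho b (b j) (rho b (b k) (z F P))) =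
      rho b (b k) (rho b (b i) (rho b (b j) (z F P))) + rho b ⁅b i, b k⁆ (rho b (b j) (z F P))
      + rho b ⁅b j, b k⁆ (rho b (b i) (z F P)) + rho b ⁅b i, ⁅b j, b k⁆⁆ (z F P) := by
    intro i j hki hkj
    have e1 : rho b (b j) (rho b (b k) (z F P)) =
        rho b (b k) (rho b (b j) (z F P)) + rho b ⁅b j, b k⁆ (z F P) := by
      rw [ihP]; abel
    have e2 : rho b (b i) (rho b (b k) (rho b (b j) (z F P))) =
        rho b (b k) (rho b (b i) (rho b (b j) (z F P))) +
          rho b ⁅b i, b k⁆ (rho b (b j) (z F P)) := by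
      have h1 := ih P.card hPd (b i) (b k) _ (rho_lead b j P)
      have h2 := rho_rec b i k (j ::ₘ P) (by
        intro l hl
        rcases Multiset.mem_cons.1 hl with rfl | hl
        · exact hkj.le
        · exact hk l hl) hki
      simp only [map_sub] at h1
      rw [h2] at h1
      rw [sub_eq_iff_eq_add] at h1
      rw [h1]; abel
    rw [e1, map_add, e2, ihP (b i) ⁅b j, b k⁆]
    abel
  rw [key i j (hkj.trans hji) hkj, key j i hkj (hkj.trans hji)]
  have e3 : rho b ⁅b i, b j⁆ (rho b (b k) (z F P)) =
      rho b (b k) (rho b ⁅b i, b j⁆ (z F P)) + rho b ⁅⁅b i, b j⁆, b k⁆ (z F P) := by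
    rw [ihP ⁅b i, b j⁆ (b k)]; abel
  rw [e3, ihP (b i) (b j), lie_lie]
  simp only [map_sub, LinearMap.sub_apply]
  abel

attribute [local instance] LieRing.ofAssociativeRing

theorem U_adjoin (A : Subalgebra F (UniversalEnvelopingAlgebra F L))
    (h : ∀ x : L, UniversalEnvelopingAlgebra.ι F x ∈ A) : A = ⊤ := by
  let f : L →ₗ⁅F⁆ A :=
    { toFun := fun x => ⟨UniversalEnvelopingAlgebra.ι F x, h x⟩
      map_add' := fun x y => by ext; simp
      map_smul' := fun x y => by ext; simp
      map_lie' := fun {x y} => by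
        ext
        simp only [LieHom.map_lie, LieRing.of_associative_ring_bracket, Subalgebra.coe_sub,
          Subalgebra.coe_mul] }
  have key : A.val.comp (UniversalEnvelopingAlgebra.lift F f) = AlgHom.id F _ := by
    apply UniversalEnvelopingAlgebra.hom_ext
    ext x
    change ((UniversalEnvelopingAlgebra.lift F f (UniversalEnvelopingAlgebra.ι F x) : A) :
      UniversalEnvelopingAlgebra F L) = UniversalEnvelopingAlgebra.ι F x
    rw [UniversalEnvelopingAlgebra.lift_ι_apply]
    rfl
  rw [eq_top_iff]
  intro u _
  have := AlgHom.congr_fun key u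
  rw [AlgHom.id_apply] at this
  rw [← this]
  exact (UniversalEnvelopingAlgebra.lift F f u).2

/-- The Lie algebra representation on `V`. -/
noncomputable def rhoLie : L →ₗ⁅F⁆ Module.End F (V F n) :=
  { rho b with
    map_lie' := by
      intro x y
      ext1 M
      ext1
      obtain ⟨d, hd⟩ := exists_mem_Vle (z F M)
      exact rho_lie_aux b d x y _ hd }

/-- The representation of the enveloping algebra on `V`. -/
noncomputable def rhoU : UniversalEnvelopingAlgebra F L →ₐ[F] Module.End F (V F n) :=
  UniversalEnvelopingAlgebra.lift F (rhoLie b)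

theorem rhoU_ι (x : L) : rhoU b (UniversalEnvelopingAlgebra.ι F x) = rho b x := by
  rw [rhoU, UniversalEnvelopingAlgebra.lift_ι_apply]; rfl

/-- The ordered monomials in the enveloping algebra. -/
noncomputable def mono (M : Multiset (Fin n)) : UniversalEnvelopingAlgebra F L :=
  ((M.sort).map (fun i => UniversalEnvelopingAlgebra.ι F (b i))).prod

theorem mono_cons (j : Fin n) (N : Multiset (Fin n)) (h : ∀ k ∈ N, j ≤ k) :
    mono b (j ::ₘ N) = UniversalEnvelopingAlgebra.ι F (b j) * mono b N := by
  rw [mono, Multiset.sort_cons _ _ _ h]; simp [mono]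

/-- The linear map from `V` to the enveloping algebra. -/
noncomputable def psi : V F n →ₗ[F] UniversalEnvelopingAlgebra F L :=
  Finsupp.linearCombination F (mono b)

theorem psi_z (M : Multiset (Fin n)) : psi b (z F M) = mono b M := by simp [psi]

theorem psi_rho_aux (d : ℕ) : ∀ (x : L) (v : V F n), v ∈ Vle F n d →
    psi b (rho b x v) = UniversalEnvelopingAlgebra.ι F x * psi b v := by
  induction d using Nat.strong_induction_on with
  | _ d ih =>
  suffices H : ∀ (i : Fin n) (M : Multiset (Fin n)), M.card ≤ d →
      psi b (rho b (b i) (z F M)) = UniversalEnvelopingAlgebra.ι F (b i) * psi b (z F M) by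
    intro x v hv
    have H2 : ∀ (M : Multiset (Fin n)), M.card ≤ d →
        psi b (rho b x (z F M)) = UniversalEnvelopingAlgebra.ι F x * psi b (z F M) := by
      intro M hM
      induction b.mem_span x using Submodule.span_induction with
      | mem x hx => obtain ⟨j, rfl⟩ := hx; exact H j M hM
      | zero => simp only [map_zero, LinearMap.zero_apply, zero_mul]
      | add y y' _ _ h h' => simp only [map_add, LinearMap.add_apply, h, h', add_mul]
      | smul c y _ h => simp only [map_smul, LinearMap.smul_apply, h, smul_mul_assoc]
    exact Vle_ext (f := psi b ∘ₗ rho b x)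
      (g := LinearMap.mulLeft F (UniversalEnvelopingAlgebra.ι F x) ∘ₗ psi b)
      (fun M hM => H2 M hM) hv
  intro i M hM
  by_cases hiM : ∀ k ∈ M, i ≤ k
  · rw [rho_of_le b i M hiM, psi_z, psi_z, mono_cons b i M hiM]
  obtain ⟨j, N, rfl, hj⟩ := exists_min M (by rintro rfl; simp at hiM)
  have hji : j < i := by
    by_contra hc
    apply hiM
    intro l hl
    rcases Multiset.mem_cons.1 hl with rfl | hl
    · exact not_lt.1 hc
    · exact (not_lt.1 hc).trans (hj l hl)
  have hNd : N.card < d := by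
    rw [Multiset.card_cons] at hM; omega
  have ihN := fun x => ih N.card hNd x (z F N) (z_mem_Vle le_rfl)
  rw [← rho_of_le b j N hj, rho_rec b i j N hj hji, map_add, ihN, ihN]
  have e : psi b (rho b (b j) (rho b (b i) (z F N))) =
      UniversalEnvelopingAlgebra.ι F (b j) * psi b (rho b (b i) (z F N)) := by
    have h1 := ih N.card hNd (b j) _ (rho_lead b i N)
    have hl : ∀ k ∈ i ::ₘ N, j ≤ k := by
      intro l hl
      rcases Multiset.mem_cons.1 hl with rfl | hl
      · exact hji.le
      · exact hj l hl
    have h2 : psi b (rho b (b j) (z F (i ::ₘ N))) =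
        UniversalEnvelopingAlgebra.ι F (b j) * psi b (z F (i ::ₘ N)) := by
      rw [rho_of_le b j _ hl, psi_z, psi_z, mono_cons b j _ hl]
    simp only [map_sub, mul_sub] at h1
    rw [h2] at h1
    exact sub_left_injective h1
  rw [e, ihN, LieHom.map_lie, LieRing.of_associative_ring_bracket]
  noncomm_ring

theorem psi_rhoU (u : UniversalEnvelopingAlgebra F L) (v : V F n) :
    psi b (rhoU b u v) = u * psi b v := by
  let A : Subalgebra F (UniversalEnvelopingAlgebra F L) :=
    { carrier := {u | ∀ v, psi b (rhoU b u v) = u * psi b v}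
      algebraMap_mem' := fun r v => by
        rw [AlgHom.commutes, Module.algebraMap_end_apply, map_smul, Algebra.smul_def]
      mul_mem' := fun {u w} hu hw v => by
        rw [map_mul, Module.End.mul_apply, hu, hw, mul_assoc]
      add_mem' := fun {u w} hu hw v => by
        rw [map_add, LinearMap.add_apply, map_add, hu, hw, add_mul] }
  have hA : A = ⊤ := by
    refine U_adjoin A fun x v => ?_
    rw [rhoU_ι]
    obtain ⟨d, hd⟩ := exists_mem_Vle v
    exact psi_rho_aux b d x v hd
  have hu : u ∈ A := by rw [hA]; trivial
  exact hu v

theorem rhoU_mono (M : Multiset (Fin n)) : rhoU b (mono b M) (z F 0) = z F M := by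
  induction hd : M.card generalizing M with
  | zero =>
    obtain rfl : M = 0 := by simpa using hd
    simp [mono]
  | succ d ih =>
    obtain ⟨j, N, rfl, hj⟩ := exists_min M (by rintro rfl; simp at hd)
    rw [mono_cons b j N hj, map_mul, Module.End.mul_apply, ih N (by simpa using hd), rhoU_ι,
      rho_of_le b j N hj]

/-- `V` and the enveloping algebra are isomorphic. -/
noncomputable def psiEquiv : V F n ≃ₗ[F] UniversalEnvelopingAlgebra F L :=
  LinearEquiv.ofLinearMap (psi b) ((rhoU b).toLinearMap.flip (z F 0))
    (by
      ext u
      have := psi_rhoU b u (z F 0)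
      simpa [psi_z, mono] using this)
    (by
      ext1 M
      ext1
      simp only [LinearMap.comp_apply, LinearMap.flip_apply, Finsupp.lsingle_apply,
        LinearMap.id_apply, AlgHom.toLinearMap_apply]
      rw [psi_z, rhoU_mono])

/-- The PBW basis. -/
noncomputable def pbw : Module.Basis (Multiset (Fin n)) F (UniversalEnvelopingAlgebra F L) :=
  Module.Basis.ofRepr (psiEquiv b).symm

theorem pbw_apply (M : Multiset (Fin n)) : pbw b M = mono b M := by
  rw [← psi_z]; rfl

theorem pbw_zero : pbw b 0 = 1 := by simp [pbw_apply, mono]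

theorem pbw_lead (i : Fin n) (M : Multiset (Fin n)) :
    UniversalEnvelopingAlgebra.ι F (b i) * pbw b M - pbw b (i ::ₘ M) ∈
      Submodule.span F (pbw b '' {N | N.card ≤ M.card}) := by
  have h := Submodule.mem_map_of_mem (f := psi b) (rho_lead b i M)
  rw [Vle, Submodule.map_span, Set.image_image, map_sub, psi_rho_aux b _ _ _ (z_mem_Vle le_rfl)] at h
  simpa only [psi_z, ← pbw_apply] using h

end PBW



namespace Filt

section general

variable {F : Type*} [Field F] {R : Type*} [Ring R] [Algebra F R]
variable {X : Type*} [AddCommGroup X] [Module R X] [Module F X] [IsScalarTower F R X]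

/-- Multiplication by an element of the algebra, as a linear map. -/
def lmul (F : Type*) [Field F] {R : Type*} [Ring R] [Algebra F R]
    (X : Type*) [AddCommGroup X] [Module R X] [Module F X] [IsScalarTower F R X] (r : R) :
    X →ₗ[F] X where
  toFun m := r • m
  map_add' := smul_add r
  map_smul' c m := by
    rw [RingHom.id_apply, ← algebraMap_smul R c m, ← algebraMap_smul R c (r • m), smul_smul,
      smul_smul, Algebra.commutes]

@[simp] theorem lmul_apply (r : R) (m : X) : lmul F X r m = r • m := rfl

/-- Filtrations compatible with the generators. -/
structure IsFilt (x : ℕ → R) (G : ℕ → Submodule F X) : Prop where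
  zero : G 0 = ⊥
  mono : Monotone G
  exh : ∀ m, ∃ d, m ∈ G d
  smul : ∀ j d m, m ∈ G d → x j • m ∈ G (d + 1)
  comm : ∀ i j d m, m ∈ G d → x i • x j • m - x j • x i • m ∈ G (d + 1)

/-- The submodules generated in lower degree and by the first generators. -/
def W (x : ℕ → R) (G : ℕ → Submodule F X) : ℕ → ℕ → Submodule F X
  | _, 0 => ⊥
  | 0, d + 1 => G d
  | j + 1, d + 1 => W x G j (d + 1) ⊔ (G d).map (lmul F X (x j))

/-- Regularity of the first `k` generators on the associated graded module. -/
def Reg (x : ℕ → R) (G : ℕ → Submodule F X) (k : ℕ) : Prop :=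
  ∀ j < k, ∀ d m, m ∈ G d → x j • m ∈ W x G j (d + 1) → m ∈ W x G j d

variable {x : ℕ → R} {G : ℕ → Submodule F X}

@[simp] theorem W_zero_right (j : ℕ) : W x G j 0 = ⊥ := by cases j <;> rfl

theorem W_zero_succ (d : ℕ) : W x G 0 (d + 1) = G d := rfl

theorem mem_W_succ {j d : ℕ} {m : X} :
    m ∈ W x G (j + 1) (d + 1) ↔ ∃ w ∈ W x G j (d + 1), ∃ g ∈ G d, w + x j • g = m := by
  change m ∈ W x G j (d + 1) ⊔ (G d).map (lmul F X (x j)) ↔ _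
  simp [Submodule.mem_sup]

theorem W_le_succ (j d : ℕ) : W x G j d ≤ W x G (j + 1) d := by
  cases d with
  | zero => simp
  | succ d => exact le_sup_left

theorem G_le_W (j d : ℕ) : G d ≤ W x G j (d + 1) := by
  induction j with
  | zero => exact le_rfl
  | succ j ih => exact ih.trans (W_le_succ j _)

theorem smul_mem_W {i j d : ℕ} (hij : i < j) {m : X} (hm : m ∈ G d) :
    x i • m ∈ W x G j (d + 1) := by
  induction j with
  | zero => omega
  | succ j ih =>
    rcases Nat.lt_succ_iff_lt_or_eq.1 hij with h | rfl
    · exact W_le_succ _ _ (ih h)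
    · exact mem_W_succ.2 ⟨0, zero_mem _, m, hm, zero_add _⟩

theorem IsFilt.W_le (h : IsFilt x G) (j d : ℕ) : W x G j d ≤ G d := by
  cases d with
  | zero => simp
  | succ d =>
    induction j with
    | zero => exact h.mono (Nat.le_succ d)
    | succ j ih =>
      intro m hm
      obtain ⟨w, hw, g, hg, rfl⟩ := mem_W_succ.1 hm
      exact add_mem (ih hw) (h.smul j d g hg)

theorem IsFilt.smul_W (h : IsFilt x G) (i j d : ℕ) {m : X} (hm : m ∈ W x G j d) :
    x i • m ∈ W x G j (d + 1) := by
  cases d with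
  | zero =>
    rw [W_zero_right, Submodule.mem_bot] at hm
    rw [hm, smul_zero]; exact zero_mem _
  | succ d =>
    induction j generalizing m with
    | zero => exact h.smul i d m hm
    | succ j ih =>
      obtain ⟨w, hw, g, hg, rfl⟩ := mem_W_succ.1 hm
      refine mem_W_succ.2 ⟨x i • w + (x i • x j • g - x j • x i • g),
        add_mem (ih hw) (G_le_W _ _ (h.comm i j d g hg)), x i • g, h.smul i d g hg, ?_⟩
      rw [smul_add]; abel

theorem Reg.mono {k l : ℕ} (h : Reg x G k) (hl : l ≤ k) : Reg x G l :=
  fun j hj => h j (hj.trans_le hl)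

variable {P : Type*} [AddCommGroup P] [Module R P] [Module F P] [IsScalarTower F R P]
  {H : ℕ → Submodule F P} {f : P →ₗ[R] X}

theorem map_W (hf : ∀ d m, m ∈ H d → f m ∈ G d) (j d : ℕ) {m : P} (hm : m ∈ W x H j d) :
    f m ∈ W x G j d := by
  cases d with
  | zero => 
    rw [W_zero_right, Submodule.mem_bot] at hm
    rw [hm, map_zero]; exact zero_mem _
  | succ d =>
    induction j generalizing m with
    | zero => exact hf d m hm
    | succ j ih =>
      obtain ⟨w, hw, g, hg, rfl⟩ := mem_W_succ.1 hm
      exact mem_W_succ.2 ⟨f w, ih hw, f g, hf d g hg, by simp⟩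

theorem lift_W {d : ℕ} (hf : ∀ e < d, ∀ m ∈ G e, ∃ p ∈ H e, f p = m) (j : ℕ) {m : X}
    (hm : m ∈ W x G j d) : ∃ p ∈ W x H j d, f p = m := by
  cases d with
  | zero => 
    rw [W_zero_right, Submodule.mem_bot] at hm
    exact ⟨0, zero_mem _, by simp [hm]⟩
  | succ d =>
    induction j generalizing m with
    | zero => exact hf d (Nat.lt_succ_self d) m hm
    | succ j ih =>
      obtain ⟨w, hw, g, hg, rfl⟩ := mem_W_succ.1 hm
      obtain ⟨w', hw', rfl⟩ := ih hw
      obtain ⟨g', hg', rfl⟩ := hf d (Nat.lt_succ_self d) g hg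
      exact ⟨w' + x j • g', mem_W_succ.2 ⟨w', hw', g', hg', rfl⟩, by simp⟩

/-- induced filtration on the kernel -/
def kerFilt (H : ℕ → Submodule F P) (f : P →ₗ[R] X) (d : ℕ) : Submodule F (LinearMap.ker f) :=
  (H d).comap ((LinearMap.ker f).subtype.restrictScalars F)

theorem mem_kerFilt {d : ℕ} {k : LinearMap.ker f} : k ∈ kerFilt H f d ↔ (k : P) ∈ H d := Iff.rfl

theorem kerFilt_isFilt (h : IsFilt x H) : IsFilt x (kerFilt H f) where
  zero := by
    rw [eq_bot_iff]
    intro k hk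
    rw [mem_kerFilt, h.zero, Submodule.mem_bot] at hk
    rw [Submodule.mem_bot]
    exact Subtype.ext hk
  mono := fun _ _ hd _ hk => h.mono hd hk
  exh := fun k => h.exh k
  smul := fun j d m hm => h.smul j d m hm
  comm := fun i j d m hm => h.comm i j d m hm

theorem inter_W (hH : IsFilt x H)
    (hs : ∀ d, ∀ m ∈ G d, ∃ p ∈ H d, f p = m) (hf : ∀ d m, m ∈ H d → f m ∈ G d)
    (j : ℕ) (hr : Reg x G j) (d : ℕ) (k : LinearMap.ker f)
    (hk : (k : P) ∈ W x H j d) : k ∈ W x (kerFilt H f) j d := by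
  cases d with
  | zero =>
    rw [W_zero_right, Submodule.mem_bot] at hk ⊢
    exact Subtype.ext hk
  | succ d =>
    induction j generalizing k with
    | zero => exact hk
    | succ j ih =>
      obtain ⟨w, hw, q, hq, hwq⟩ := mem_W_succ.1 hk
      have h1 : x j • f q ∈ W x G j (d + 1) := by
        have h2 : f w + x j • f q = 0 := by
          rw [← map_smul, ← map_add, hwq]; exact k.2
        rw [eq_neg_of_add_eq_zero_right h2]
        exact neg_mem (map_W hf _ _ hw)
      have h3 := hr j (Nat.lt_succ_self j) d (f q) (hf d q hq) h1
      obtain ⟨w', hw', hw'q⟩ := lift_W (fun e _ => hs e) j h3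
      let k' : LinearMap.ker f := ⟨q - w', by rw [LinearMap.mem_ker, map_sub, hw'q, sub_self]⟩
      refine mem_W_succ.2 ⟨k - x j • k', ?_, k', ?_, by abel⟩
      · refine ih (hr.mono (Nat.le_succ j)) _ ?_
        have : ((k - x j • k' : LinearMap.ker f) : P) = w + x j • w' := by
          change (k : P) - x j • (q - w') = _
          rw [← hwq, smul_sub]; abel
        rw [this]
        exact add_mem hw (hH.smul_W j j d hw')
      · exact sub_mem hq (hH.W_le _ _ hw')

theorem W_ker_le (j d : ℕ) (k : LinearMap.ker f) (hk : k ∈ W x (kerFilt H f) j d) :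
    (k : P) ∈ W x H j d :=
  map_W (f := (LinearMap.ker f).subtype) (fun _ _ h => h) j d hk

theorem reg_ker (hH : IsFilt x H)
    (hs : ∀ d, ∀ m ∈ G d, ∃ p ∈ H d, f p = m) (hf : ∀ d m, m ∈ H d → f m ∈ G d)
    (k : ℕ) (hr : Reg x G k) (hrH : Reg x H (k + 1)) : Reg x (kerFilt H f) (k + 1) := by
  intro j hj d m hm hxm
  refine inter_W hH hs hf j (hr.mono (by omega)) d m ?_
  exact hrH j hj d m hm (W_ker_le _ _ _ hxm)

theorem ker_eq_bot (hH : IsFilt x H)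
    (hs : ∀ d, ∀ m ∈ G d, ∃ p ∈ H d, f p = m) (hf : ∀ d m, m ∈ H d → f m ∈ G d)
    (n : ℕ) (hr : Reg x G n) (hmin : ∀ d, ∀ p ∈ H d, f p = 0 → p ∈ W x H n d) :
    LinearMap.ker f = ⊥ := by
  have hbot : ∀ d, kerFilt H f d = ⊥ := by
    intro d
    induction d with
    | zero => exact (kerFilt_isFilt hH).zero
    | succ d ih =>
      rw [eq_bot_iff]
      intro k hk
      have h1 := inter_W hH hs hf n hr _ k (hmin _ _ hk k.2)
      have h2 : ∀ j, W x (kerFilt H f) j (d + 1) = ⊥ := by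
        intro j
        induction j with
        | zero => exact ih
        | succ j ihj =>
          change W x (kerFilt H f) j (d + 1) ⊔ (kerFilt H f d).map _ = ⊥
          rw [ihj, ih]; simp
      rwa [h2] at h1
  rw [eq_bot_iff]
  intro p hp
  obtain ⟨d, hd⟩ := hH.exh p
  have : (⟨p, hp⟩ : LinearMap.ker f) ∈ kerFilt H f d := hd
  rw [hbot, Submodule.mem_bot] at this
  exact congrArg Subtype.val this

/-! ### Free modules -/

/-- filtration on free modules -/
def freeFilt (G : ℕ → Submodule F R) {ι : Type*} (deg : ι → ℕ) (d : ℕ) : Submodule F (ι →₀ R) where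
  carrier := {f | ∀ i, f i ∈ G (d - deg i)}
  add_mem' := fun hf hg i => add_mem (hf i) (hg i)
  zero_mem' := fun i => zero_mem _
  smul_mem' := fun c f hf i => Submodule.smul_mem _ c (hf i)

section free
variable {A : ℕ → Submodule F R} {ι : Type*} {deg : ι → ℕ}

theorem mem_freeFilt {d : ℕ} {f : ι →₀ R} :
    f ∈ freeFilt A deg d ↔ ∀ i, f i ∈ A (d - deg i) := Iff.rfl

theorem freeFilt_isFilt (h : IsFilt x A) : IsFilt x (freeFilt A deg) where
  zero := by
    rw [eq_bot_iff]
    intro f hf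
    rw [Submodule.mem_bot]
    ext i
    have := hf i
    rwa [Nat.zero_sub, h.zero, Submodule.mem_bot] at this
  mono := fun d e hd f hf i => h.mono (Nat.sub_le_sub_right hd _) (hf i)
  exh := fun f => by
    induction f using Finsupp.induction_linear with
    | zero => exact ⟨0, zero_mem _⟩
    | add f g hf hg =>
      obtain ⟨d, hd⟩ := hf
      obtain ⟨e, he⟩ := hg
      exact ⟨max d e, fun i => add_mem (h.mono (Nat.sub_le_sub_right (le_max_left _ _) _) (hd i))
        (h.mono (Nat.sub_le_sub_right (le_max_right _ _) _) (he i))⟩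
    | single i r =>
      obtain ⟨d, hd⟩ := h.exh r
      refine ⟨d + deg i, fun j => ?_⟩
      by_cases hij : i = j
      · subst hij; simpa using hd
      · rw [Finsupp.single_eq_of_ne (Ne.symm hij)]; exact zero_mem _
  smul := fun j d f hf i => by
    have h1 := hf i
    rw [Finsupp.smul_apply]
    by_cases hd : deg i ≤ d
    · have := h.smul j _ _ h1
      rwa [← Nat.sub_add_comm hd] at this
    · rw [Nat.sub_eq_zero_of_le (by omega), h.zero, Submodule.mem_bot] at h1
      rw [h1, smul_zero]; exact zero_mem _
  comm := fun j k d f hf i => by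
    have h1 := hf i
    simp only [Finsupp.smul_apply, Finsupp.sub_apply]
    by_cases hd : deg i ≤ d
    · have := h.comm j k _ _ h1
      rwa [← Nat.sub_add_comm hd] at this
    · rw [Nat.sub_eq_zero_of_le (by omega), h.zero, Submodule.mem_bot] at h1
      rw [h1]; simp

theorem mem_W_free (h : IsFilt x A) {j d : ℕ} {f : ι →₀ R} :
    f ∈ W x (freeFilt A deg) j d ↔ ∀ i, f i ∈ W x A j (d - deg i) := by
  constructor
  · cases d with
    | zero => 
      intro hf i
      rw [W_zero_right, Submodule.mem_bot] at hf
      rw [hf]; exact zero_mem _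
    | succ d =>
      induction j generalizing f with
      | zero =>
        intro hf i
        have h1 : f i ∈ A (d - deg i) := hf i
        by_cases hd : deg i ≤ d
        · rw [Nat.sub_add_comm hd]; exact h1
        · rw [Nat.sub_eq_zero_of_le (by omega), h.zero, Submodule.mem_bot] at h1
          rw [h1]; exact zero_mem _
      | succ j ih =>
        intro hf i
        obtain ⟨w, hw, g, hg, rfl⟩ := mem_W_succ.1 hf
        have h2 := ih hw i
        have h1 := hg i
        by_cases hd : deg i ≤ d
        · rw [Nat.sub_add_comm hd] at h2 ⊢
          exact mem_W_succ.2 ⟨_, h2, _, h1, rfl⟩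
        · rw [Nat.sub_eq_zero_of_le (by omega), h.zero, Submodule.mem_bot] at h1
          rw [Finsupp.add_apply, Finsupp.smul_apply, h1, smul_zero, add_zero]
          exact W_le_succ _ _ h2
  · intro hf
    have key : ∀ i r, r ∈ W x A j (d - deg i) →
        Finsupp.single i r ∈ W x (freeFilt A deg) j d := by
      intro i r hr
      by_cases hd : d ≤ deg i
      · rw [Nat.sub_eq_zero_of_le hd, W_zero_right, Submodule.mem_bot] at hr
        rw [hr, Finsupp.single_zero]; exact zero_mem _
      obtain ⟨e, rfl⟩ := Nat.exists_eq_add_of_lt (not_le.1 hd)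
      have e1 : deg i + e + 1 - deg i = e + 1 := by omega
      have hsing : ∀ g, g ∈ A e → Finsupp.single i g ∈ freeFilt A deg (deg i + e) := by
        intro g hg k
        by_cases hik : i = k
        · subst hik; simpa using hg
        · rw [Finsupp.single_eq_of_ne (Ne.symm hik)]; exact zero_mem _
      rw [e1] at hr
      clear hf
      induction j generalizing r with
      | zero => exact hsing r hr
      | succ j ih =>
        obtain ⟨w, hw, g, hg, rfl⟩ := mem_W_succ.1 hr
        refine mem_W_succ.2 ⟨_, ih w hw, _, hsing g hg, ?_⟩
        rw [Finsupp.smul_single, Finsupp.single_add]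
    rw [← Finsupp.sum_single f]
    exact Submodule.sum_mem _ fun i _ => key i _ (hf i)

theorem reg_free (h : IsFilt x A) {k : ℕ} (hr : Reg x A k) : Reg x (freeFilt A deg) k := by
  intro j hj d f hf hxf
  rw [mem_W_free h] at hxf ⊢
  intro i
  have h1 := hf i
  have h2 := hxf i
  by_cases hd : deg i ≤ d
  · rw [Nat.sub_add_comm hd] at h2
    exact hr j hj _ _ h1 h2
  · rw [Nat.sub_eq_zero_of_le (by omega), h.zero, Submodule.mem_bot] at h1
    rw [h1]; exact zero_mem _

end free

end general

end Filt



/-- An algebra with a basis of PBW type. -/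
structure PData (F : Type*) [Field F] (R : Type*) [Ring R] [Algebra F R] (n : ℕ) where
  b : Module.Basis (Multiset (Fin n)) F R
  x : Fin n → R
  one : b 0 = 1
  lead : ∀ i M, x i * b M - b (i ::ₘ M) ∈ Submodule.span F (b '' {N | N.card ≤ M.card})
  comm : ∀ i j, x i * x j - x j * x i ∈ Submodule.span F (Set.range x)

namespace PData

variable {F : Type*} [Field F] {R : Type*} [Ring R] [Algebra F R] {n : ℕ} (D : PData F R n)

/-- elements of degree less than `d` -/
def low (d : ℕ) : Submodule F R := Submodule.span F (D.b '' {M | M.card < d})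

theorem mem_low {d : ℕ} {r : R} : r ∈ D.low d ↔ ∀ M, D.b.repr r M ≠ 0 → M.card < d := by
  unfold low
  rw [D.b.mem_span_image]
  simp [Set.subset_def]

theorem b_mem_low {d : ℕ} {M : Multiset (Fin n)} (h : M.card < d) : D.b M ∈ D.low d :=
  Submodule.subset_span ⟨M, h, rfl⟩

theorem low_mono {d e : ℕ} (h : d ≤ e) : D.low d ≤ D.low e :=
  Submodule.span_mono (Set.image_mono fun _ hM => lt_of_lt_of_le hM h)

theorem low_zero : D.low 0 = ⊥ := by simp [low]

theorem exists_low (r : R) : ∃ d, r ∈ D.low d := by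
  refine ⟨((D.b.repr r).support.sup Multiset.card) + 1, D.mem_low.2 fun M hM => ?_⟩
  exact Nat.lt_succ_of_le (Finset.le_sup (f := Multiset.card) (Finsupp.mem_support_iff.2 hM))

/-- shift of the basis -/
noncomputable def T (A : Multiset (Fin n)) : R →ₗ[F] R := D.b.constr F fun M => D.b (M + A)

theorem T_b (A M : Multiset (Fin n)) : D.T A (D.b M) = D.b (M + A) := by simp [T]

theorem repr_T (A : Multiset (Fin n)) (r : R) :
    D.b.repr (D.T A r) = (D.b.repr r).mapDomain (· + A) := by
  have : D.b.repr.toLinearMap ∘ₗ D.T A =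
      Finsupp.lmapDomain F F (· + A) ∘ₗ D.b.repr.toLinearMap := by
    refine D.b.ext fun M => ?_
    simp [T_b]
  exact LinearMap.congr_fun this r

theorem repr_T_add (A M : Multiset (Fin n)) (r : R) :
    D.b.repr (D.T A r) (M + A) = D.b.repr r M := by
  rw [repr_T]
  exact Finsupp.mapDomain_apply (add_left_injective A) _ M

theorem repr_T_ne {A N : Multiset (Fin n)} {r : R} (h : D.b.repr (D.T A r) N ≠ 0) :
    ∃ M, N = M + A ∧ D.b.repr r M ≠ 0 := by
  have : ∃ M, M + A = N := by
    by_contra hn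
    apply h
    rw [repr_T]
    exact Finsupp.mapDomain_of_notMem_range _ _ hn
  obtain ⟨M, rfl⟩ := this
  exact ⟨M, rfl, by rwa [repr_T_add] at h⟩

/-- `r` has leading monomial `A`. -/
def Lead (r : R) (A : Multiset (Fin n)) : Prop :=
  ∀ M, r * D.b M - D.b (M + A) ∈ D.low (M.card + A.card)

theorem Lead.sub_T {r : R} {A : Multiset (Fin n)} (h : D.Lead r A) {d : ℕ} {v : R}
    (hv : v ∈ D.low (d + 1)) : r * v - D.T A v ∈ D.low (d + A.card) := by
  unfold low at hv
  induction hv using Submodule.span_induction with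
  | mem v hv =>
    obtain ⟨M, hM, rfl⟩ := hv
    rw [T_b]
    have hM' : M.card < d + 1 := hM
    exact D.low_mono (by omega) (h M)
  | zero => simp
  | add v w _ _ hv hw =>
    rw [mul_add, map_add, add_sub_add_comm]; exact add_mem hv hw
  | smul c v _ hv =>
    rw [mul_smul_comm, map_smul, ← smul_sub]; exact Submodule.smul_mem _ _ hv

theorem lead_x (i : Fin n) : D.Lead (D.x i) {i} := by
  intro M
  have := D.lead i M
  rw [add_comm M, Multiset.singleton_add, Multiset.card_singleton]
  refine Submodule.span_mono (Set.image_mono fun N hN => ?_) this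
  exact Nat.lt_succ_of_le hN

theorem T_mem {A : Multiset (Fin n)} {d : ℕ} {v : R} (hv : v ∈ D.low d) :
    D.T A v ∈ D.low (d + A.card) := by
  rw [mem_low] at hv ⊢
  intro N hN
  obtain ⟨M, rfl, hM⟩ := D.repr_T_ne hN
  have := hv M hM
  rw [Multiset.card_add]; omega

theorem Lead.mul_mem {r : R} {A : Multiset (Fin n)} (h : D.Lead r A) {d : ℕ} {v : R}
    (hv : v ∈ D.low d) : r * v ∈ D.low (d + A.card) := by
  rcases d with _ | d
  · rw [low_zero, Submodule.mem_bot] at hv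
    simp [hv]
  · have h1 := h.sub_T D hv
    have h2 := D.T_mem (A := A) hv
    have := add_mem (D.low_mono (by omega : d + A.card ≤ d + 1 + A.card) h1) h2
    simpa using this

/-- generators indexed by natural numbers -/
def xx (j : ℕ) : R := if h : j < n then D.x ⟨j, h⟩ else 0

theorem xx_fin (i : Fin n) : D.xx i = D.x i := by simp [xx]

theorem xx_cases (j : ℕ) : D.xx j = 0 ∨ ∃ i, D.xx j = D.x i := by
  unfold xx
  split_ifs with h
  · exact Or.inr ⟨_, rfl⟩
  · exact Or.inl rfl

theorem xx_comm_mem (i j : ℕ) : D.xx i * D.xx j - D.xx j * D.xx i ∈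
    Submodule.span F (Set.range D.x) := by
  rcases D.xx_cases i with hi | ⟨i', hi⟩ <;> rcases D.xx_cases j with hj | ⟨j', hj⟩ <;>
    simp only [hi, hj, mul_zero, zero_mul, sub_zero, zero_mem, D.comm]

theorem comm_of_smul {X : Type*} [AddCommGroup X] [Module R X] [Module F X] [IsScalarTower F R X]
    {G : ℕ → Submodule F X} (hs : ∀ i d m, m ∈ G d → D.x i • m ∈ G (d + 1))
    (i j d : ℕ) (m : X) (hm : m ∈ G d) :
    D.xx i • D.xx j • m - D.xx j • D.xx i • m ∈ G (d + 1) := by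
  rw [smul_smul, smul_smul, ← sub_smul]
  have h := D.xx_comm_mem i j
  generalize D.xx i * D.xx j - D.xx j * D.xx i = r at h
  induction h using Submodule.span_induction with
  | mem v hv => obtain ⟨k, rfl⟩ := hv; exact hs k d m hm
  | zero => simp
  | add v w _ _ hv hw => rw [add_smul]; exact add_mem hv hw
  | smul c v _ hv => rw [smul_assoc]; exact Submodule.smul_mem _ _ hv

theorem isFilt_of {X : Type*} [AddCommGroup X] [Module R X] [Module F X] [IsScalarTower F R X]
    {G : ℕ → Submodule F X} (h0 : G 0 = ⊥) (hmono : Monotone G) (hex : ∀ m, ∃ d, m ∈ G d)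
    (hs : ∀ i d m, m ∈ G d → D.x i • m ∈ G (d + 1)) : Filt.IsFilt D.xx G where
  zero := h0
  mono := hmono
  exh := hex
  smul := fun j d m hm => by
    rcases D.xx_cases j with hj | ⟨i, hj⟩
    · rw [hj, zero_smul]; exact zero_mem _
    · rw [hj]; exact hs i d m hm
  comm := D.comm_of_smul hs

theorem isFilt_low : Filt.IsFilt D.xx D.low :=
  D.isFilt_of D.low_zero (fun _ _ h => D.low_mono h) D.exists_low fun i d m hm => by
    simpa using (D.lead_x i).mul_mem D hm

/-- explicit description of `W` -/
def Wl (j d : ℕ) : Submodule F R :=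
  Submodule.span F (D.b '' {M | M.card < d ∨ (M.card = d ∧ ∃ i ∈ M, i.val < j)})

theorem mem_Wl {j d : ℕ} {r : R} : r ∈ D.Wl j d ↔
    ∀ M, D.b.repr r M ≠ 0 → M.card < d ∨ (M.card = d ∧ ∃ i ∈ M, i.val < j) := by
  unfold Wl
  rw [D.b.mem_span_image]
  simp only [Set.subset_def, Finset.mem_coe, Finsupp.mem_support_iff, Set.mem_ofPred_eq]

theorem low_le_Wl (j d : ℕ) : D.low d ≤ D.Wl j d :=
  Submodule.span_mono (Set.image_mono fun _ hM => Or.inl hM)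

theorem Wl_mono {j k d : ℕ} (h : j ≤ k) : D.Wl j d ≤ D.Wl k d :=
  Submodule.span_mono (Set.image_mono fun _ hM => hM.imp_right fun ⟨h1, i, hi, hij⟩ =>
    ⟨h1, i, hi, lt_of_lt_of_le hij h⟩)

theorem W_le_Wl (j d : ℕ) : Filt.W D.xx D.low j (d + 1) ≤ D.Wl j d := by
  induction j with
  | zero => exact D.low_le_Wl 0 d
  | succ j ih =>
    intro r hr
    obtain ⟨w, hw, g, hg, rfl⟩ := Filt.mem_W_succ.1 hr
    refine add_mem (D.Wl_mono (Nat.le_succ j) (ih hw)) ?_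
    by_cases hj : j < n
    swap
    · simp [xx, hj]
    have hxx : D.xx j = D.x ⟨j, hj⟩ := by simp [xx, hj]
    rw [hxx, smul_eq_mul]
    rcases d with _ | d
    · rw [low_zero, Submodule.mem_bot] at hg
      simp [hg]
    have h1 := (D.lead_x ⟨j, hj⟩).sub_T D hg
    have h2 : D.T {⟨j, hj⟩} g ∈ D.Wl (j + 1) (d + 1) := by
      rw [mem_Wl]
      intro N hN
      obtain ⟨M, rfl, hM⟩ := D.repr_T_ne hN
      have := D.mem_low.1 hg M hM
      rw [Multiset.card_add, Multiset.card_singleton]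
      rcases Nat.lt_succ_iff_lt_or_eq.1 this with h | h
      · left; omega
      · right; exact ⟨by omega, ⟨j, hj⟩, by simp, Nat.lt_succ_self j⟩
    have := add_mem (D.low_le_Wl (j + 1) _ h1) h2
    simpa using this

theorem Wl_le_W (j d : ℕ) : D.Wl j d ≤ Filt.W D.xx D.low j (d + 1) := by
  refine Submodule.span_le.2 ?_
  rintro _ ⟨M, hM | ⟨hM, i, hi, hij⟩, rfl⟩
  · exact Filt.G_le_W _ _ (D.b_mem_low hM)
  · obtain ⟨N, rfl⟩ := Multiset.exists_cons_of_mem hi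
    rw [Multiset.card_cons] at hM
    have h1 : D.x i * D.b N ∈ Filt.W D.xx D.low j (d + 1) := by
      rw [← D.xx_fin i, ← smul_eq_mul]
      exact Filt.smul_mem_W hij (D.b_mem_low (by omega))
    have h2 : D.x i * D.b N - D.b (i ::ₘ N) ∈ D.low d := by
      have := D.lead_x i N
      rwa [add_comm N, Multiset.singleton_add, Multiset.card_singleton, hM] at this
    have := sub_mem h1 (Filt.G_le_W j d h2)
    simpa using this

theorem reg_low : Filt.Reg D.xx D.low n := by
  intro j hj d m hm hxm
  rcases d with _ | e
  · rw [low_zero, Submodule.mem_bot] at hm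
    simp [hm]
  apply D.Wl_le_W
  have hxm' := D.W_le_Wl _ _ hxm
  rw [mem_Wl] at hxm' ⊢
  intro M hM
  have hcard := D.mem_low.1 hm M hM
  rcases Nat.lt_succ_iff_lt_or_eq.1 hcard with h | h
  · exact Or.inl h
  refine Or.inr ⟨h, ?_⟩
  have hxx : D.xx j = D.x ⟨j, hj⟩ := by simp [xx, hj]
  have h1 := (D.lead_x ⟨j, hj⟩).sub_T D hm
  have h2 : D.b.repr (D.xx j • m) (M + {⟨j, hj⟩}) ≠ 0 := by
    have h3 : D.xx j • m = (D.x ⟨j, hj⟩ * m - D.T {⟨j, hj⟩} m) + D.T {⟨j, hj⟩} m := by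
      rw [hxx]; simp
    rw [h3, D.b.repr.map_add, Finsupp.add_apply, repr_T_add]
    have : D.b.repr (D.x ⟨j, hj⟩ * m - D.T {⟨j, hj⟩} m) (M + {⟨j, hj⟩}) = 0 := by
      by_contra hne
      have := D.mem_low.1 h1 _ hne
      rw [Multiset.card_add, Multiset.card_singleton] at this
      omega
    rwa [this, zero_add]
  rcases hxm' _ h2 with h4 | ⟨-, i, hi, hij⟩
  · rw [Multiset.card_add, Multiset.card_singleton] at h4; omega
  · refine ⟨i, ?_, hij⟩
    rw [Multiset.mem_add, Multiset.mem_singleton] at hi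
    rcases hi with hi | rfl
    · exact hi
    · simp at hij

theorem low_le_W (t : ℕ) : D.low (t + 2) ≤ Filt.W D.xx D.low n (t + 2) := by
  refine le_trans ?_ (D.Wl_le_W n (t + 1))
  refine Submodule.span_mono (Set.image_mono fun M hM => ?_)
  have hM' : M.card < t + 2 := hM
  rcases Nat.lt_succ_iff_lt_or_eq.1 hM' with h | h
  · exact Or.inl h
  · have : M ≠ 0 := by rintro rfl; simp at h
    obtain ⟨i, hi⟩ := Multiset.exists_mem_of_ne_zero this
    exact Or.inr ⟨h, i, hi, i.2⟩

theorem low_one {r : R} (h : r ∈ D.low 1) : r = algebraMap F R (D.b.repr r 0) := by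
  rw [Algebra.algebraMap_eq_smul_one, ← D.one]
  apply D.b.repr.injective
  ext M
  rw [map_smul, D.b.repr_self, Finsupp.smul_single, smul_eq_mul, mul_one]
  by_cases hM : M = 0
  · subst hM; simp
  · rw [Finsupp.single_eq_of_ne hM]
    by_contra hne
    have := D.mem_low.1 h M hne
    exact hM (Multiset.card_eq_zero.1 (by omega))

section modules

variable {X : Type*} [AddCommGroup X] [Module R X] [Module F X] [IsScalarTower F R X]
  {G : ℕ → Submodule F X}

theorem low_smul (hG : Filt.IsFilt D.xx G) (s t : ℕ) (r : R) (hr : r ∈ D.low t) (m : X)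
    (hm : m ∈ G (s + 1)) : r • m ∈ G (s + t) := by
  induction t generalizing r with
  | zero =>
    rw [low_zero, Submodule.mem_bot] at hr
    simp [hr]
  | succ t ih =>
    unfold low at hr
    induction hr using Submodule.span_induction with
    | zero => simp
    | add v w _ _ hv hw => rw [add_smul]; exact add_mem hv hw
    | smul c v _ hv => rw [smul_assoc]; exact Submodule.smul_mem _ _ hv
    | mem v hv =>
      obtain ⟨M, hM, rfl⟩ := hv
      have hM' : M.card < t + 1 := hM
      by_cases hM0 : M = 0
      · rw [hM0, D.one, one_smul]
        exact hG.mono (by omega) hm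
      obtain ⟨i, hi⟩ := Multiset.exists_mem_of_ne_zero hM0
      obtain ⟨N, rfl⟩ := Multiset.exists_cons_of_mem hi
      rw [Multiset.card_cons] at hM'
      have h2 : D.x i * D.b N - D.b (i ::ₘ N) ∈ D.low t := by
        have := D.lead_x i N
        rw [add_comm N, Multiset.singleton_add, Multiset.card_singleton] at this
        exact D.low_mono (by omega) this
      have h3 := ih _ h2
      have h4 := hG.smul i _ _ (ih _ (D.b_mem_low (show N.card < t by omega)))
      rw [sub_smul, mul_smul, ← D.xx_fin i] at h3
      have := sub_mem h4 (hG.mono (Nat.le_succ _) h3)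
      rw [sub_sub_cancel] at this
      exact this

end modules
end PData


namespace PData

section cover

theorem ses_zero {R : Type u} [Ring R] {A B C : Type u} [AddCommGroup A] [AddCommGroup B]
    [AddCommGroup C] [Module R A] [Module R B] [Module R C] (f : A →ₗ[R] B) (g : B →ₗ[R] C)
    (he : Function.Exact f g) : ModuleCat.ofHom f ≫ ModuleCat.ofHom g = 0 := by
  ext a; exact he.apply_apply_eq_zero a

theorem ses_shortExact {R : Type u} [Ring R] {A B C : Type u} [AddCommGroup A] [AddCommGroup B]
    [AddCommGroup C] [Module R A] [Module R B] [Module R C] (f : A →ₗ[R] B) (g : B →ₗ[R] C)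
    (hf : Function.Injective f) (hg : Function.Surjective g) (he : Function.Exact f g) :
    (ShortComplex.mk (ModuleCat.ofHom f) (ModuleCat.ofHom g) (ses_zero f g he)).ShortExact where
  exact := (ShortComplex.ShortExact.moduleCat_exact_iff_function_exact _).2 he
  mono_f := (ModuleCat.mono_iff_injective _).2 hf
  epi_g := (ModuleCat.epi_iff_surjective _).2 hg

variable {F : Type u} [Field F] {R : Type u} [Ring R] [Algebra F R] {n : ℕ} (D : PData F R n)
variable {X : Type u} [AddCommGroup X] [Module R X] [Module F X] [IsScalarTower F R X]
  {G : ℕ → Submodule F X}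

theorem exists_compl {F : Type u} [Field F] {X : Type u} [AddCommGroup X] [Module F X] (K V : Submodule F X) (hKV : K ≤ V) : ∃ (κ : Type u) (v : κ → X),
    (∀ i, v i ∈ V) ∧ (∀ m ∈ V, ∃ c : κ →₀ F, m - Finsupp.linearCombination F v c ∈ K) ∧
    (∀ c : κ →₀ F, Finsupp.linearCombination F v c ∈ K → c = 0) := by
  obtain ⟨C', hC'⟩ := Submodule.exists_isCompl K
  let C := C' ⊓ V
  let B := Module.Basis.ofVectorSpace F C
  refine ⟨_, fun i => (B i : X), fun i => (B i).2.2, ?_, ?_⟩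
  · intro m hm
    have : m ∈ K ⊔ C' := by rw [hC'.sup_eq_top]; trivial
    obtain ⟨k, hk, c, hc, rfl⟩ := Submodule.mem_sup.1 this
    have hcV : c ∈ V := by
      have := sub_mem hm (hKV hk)
      simpa using this
    let c' : C := ⟨c, hc, hcV⟩
    refine ⟨B.repr c', ?_⟩
    have h1 := congrArg C.subtype (B.linearCombination_repr c')
    rw [Finsupp.apply_linearCombination] at h1
    have h2 : Finsupp.linearCombination F (fun i => (B i : X)) (B.repr c') = c := h1
    rw [h2]; simpa using hk
  · intro c hc
    have h1 : Finsupp.linearCombination F (fun i => (B i : X)) c =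
        C.subtype (Finsupp.linearCombination F B c) := by
      rw [Finsupp.apply_linearCombination]; rfl
    rw [h1] at hc
    have h2 : C.subtype (Finsupp.linearCombination F B c) ∈ C' :=
      (Finsupp.linearCombination F B c).2.1
    have h3 := Submodule.disjoint_def.1 hC'.disjoint _ hc h2
    have h4 : Finsupp.linearCombination F B c = 0 := Subtype.ext h3
    exact (linearIndependent_iff.1 B.linearIndependent) c h4

theorem exists_cover (hG : Filt.IsFilt D.xx G) : ∃ (ι : Type u) (deg : ι → ℕ)
    (f : (ι →₀ R) →ₗ[R] X),
    (∀ d m, m ∈ Filt.freeFilt D.low deg d → f m ∈ G d) ∧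
    (∀ d, ∀ m ∈ G d, ∃ p ∈ Filt.freeFilt D.low deg d, f p = m) ∧
    (∀ d, ∀ p ∈ Filt.freeFilt D.low deg d, f p = 0 →
      p ∈ Filt.W D.xx (Filt.freeFilt D.low deg) n d) := by
  choose κ v hv1 hv2 hv3 using fun d => exists_compl (Filt.W D.xx G n (d + 1)) (G (d + 1))
    (hG.W_le n (d + 1))
  let ι := Σ d, κ d
  let deg : ι → ℕ := Sigma.fst
  let vv : ι → X := fun i => v i.1 i.2
  have hvv : ∀ i, vv i ∈ G (deg i + 1) := fun i => hv1 i.1 i.2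
  let f := Finsupp.linearCombination R vv
  have hP := Filt.freeFilt_isFilt (deg := deg) D.isFilt_low
  have hf : ∀ d m, m ∈ Filt.freeFilt D.low deg d → f m ∈ G d := by
    intro d m hm
    refine Submodule.sum_mem _ fun i _ => ?_
    have h1 := hm i
    change m i • vv i ∈ G d
    by_cases hd : deg i ≤ d
    · have := D.low_smul hG (deg i) _ _ h1 _ (hvv i)
      rwa [Nat.add_sub_cancel' hd] at this
    · rw [Nat.sub_eq_zero_of_le (by omega), D.low_zero, Submodule.mem_bot] at h1
      rw [h1, zero_smul]; exact zero_mem _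
  have hemb : ∀ d (c : κ d →₀ F), f ((c.mapRange (algebraMap F R) (map_zero _)).embDomain
      ⟨Sigma.mk d, sigma_mk_injective⟩) = Finsupp.linearCombination F (v d) c := by
    intro d c
    change Finsupp.linearCombination R vv _ = _
    rw [Finsupp.linearCombination_embDomain, Finsupp.linearCombination_apply,
      Finsupp.linearCombination_apply, Finsupp.sum_mapRange_index (by simp)]
    refine Finsupp.sum_congr fun i _ => ?_
    rw [algebraMap_smul]; rfl
  refine ⟨ι, deg, f, hf, ?_, ?_⟩
  · intro d
    induction d using Nat.strong_induction_on with
    | _ d ih =>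
      intro m hm
      rcases d with _ | d
      · rw [hG.zero, Submodule.mem_bot] at hm
        exact ⟨0, zero_mem _, by simp [hm]⟩
      obtain ⟨c, hc⟩ := hv2 d m hm
      obtain ⟨q, hq, hfq⟩ := Filt.lift_W ih n hc
      refine ⟨q + ((c.mapRange (algebraMap F R) (map_zero _)).embDomain
        ⟨Sigma.mk d, sigma_mk_injective⟩), add_mem (hP.W_le _ _ hq) ?_, ?_⟩
      · rintro ⟨e, k⟩
        by_cases he : e = d
        · subst he
          have : (⟨e, k⟩ : ι) = (⟨Sigma.mk e, sigma_mk_injective⟩ : κ e ↪ ι) k := rfl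
          rw [this, Finsupp.embDomain_apply_self, Finsupp.mapRange_apply]
          change _ ∈ D.low (e + 1 - e)
          rw [Nat.add_sub_cancel_left, Algebra.algebraMap_eq_smul_one, ← D.one]
          exact Submodule.smul_mem _ _ (D.b_mem_low (by simp))
        · rw [Finsupp.embDomain_of_notMem_range]
          · exact zero_mem _
          · rintro ⟨k', hk'⟩
            exact he (congrArg Sigma.fst hk').symm
      · rw [map_add, hfq, hemb]; abel
  · intro d g hg hfg
    rcases d with _ | d
    · rw [hP.zero] at hg; rw [Filt.W_zero_right]; exact hg
    classical
    let c : κ d →₀ F := (g.comapDomain (Sigma.mk d) (sigma_mk_injective.injOn)).mapRange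
      (fun r => D.b.repr r 0) (by simp)
    let g'' : ι →₀ R := (c.mapRange (algebraMap F R) (map_zero _)).embDomain
      ⟨Sigma.mk d, sigma_mk_injective⟩
    have hg'' : ∀ k : κ d, g'' ⟨d, k⟩ = g ⟨d, k⟩ := by
      intro k
      have : (⟨d, k⟩ : ι) = (⟨Sigma.mk d, sigma_mk_injective⟩ : κ d ↪ ι) k := rfl
      change Finsupp.embDomain _ _ _ = _
      rw [this, Finsupp.embDomain_apply_self, Finsupp.mapRange_apply]
      refine (D.low_one ?_).symm
      have := hg ⟨d, k⟩
      change _ ∈ D.low (d + 1 - d) at this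
      rwa [Nat.add_sub_cancel_left] at this
    have hg''' : ∀ e (k : κ e), e ≠ d → g'' ⟨e, k⟩ = 0 := by
      intro e k he
      refine Finsupp.embDomain_of_notMem_range _ _ _ ?_
      rintro ⟨k', hk'⟩
      exact he (congrArg Sigma.fst hk').symm
    have hW : g - g'' ∈ Filt.W D.xx (Filt.freeFilt D.low deg) n (d + 1) := by
      rw [Filt.mem_W_free D.isFilt_low]
      rintro ⟨e, k⟩
      rw [Finsupp.sub_apply]
      by_cases he : e = d
      · subst he; rw [hg'', sub_self]; exact zero_mem _
      · rw [hg''' e k he, sub_zero]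
        have h1 := hg ⟨e, k⟩
        change _ ∈ D.low (d + 1 - e) at h1
        change _ ∈ Filt.W D.xx D.low n (d + 1 - e)
        by_cases hed : e < d
        · obtain ⟨t, rfl⟩ := Nat.exists_eq_add_of_lt hed
          have e1 : e + t + 1 + 1 - e = t + 2 := by omega
          rw [e1] at h1 ⊢
          exact D.low_le_W t h1
        · rw [Nat.sub_eq_zero_of_le (by omega), D.low_zero, Submodule.mem_bot] at h1
          rw [h1]; exact zero_mem _
    have h2 := Filt.map_W hf _ _ hW
    rw [map_sub, hfg, zero_sub] at h2
    have h3 : Finsupp.linearCombination F (v d) c ∈ Filt.W D.xx G n (d + 1) := by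
      rw [← hemb d c]; simpa using h2
    have h4 := hv3 d c h3
    have h5 : g'' = 0 := by
      change Finsupp.embDomain _ (Finsupp.mapRange _ _ c) = 0
      rw [h4]; simp
    rwa [h5, sub_zero] at hW

theorem projDim {F : Type u} [Field F] {R : Type u} [Ring R] [Algebra F R] {n : ℕ} (D : PData F R n) 
    (t : ℕ) : ∀ (X : Type u) [AddCommGroup X] [Module R X] [Module F X]
    [IsScalarTower F R X] (G : ℕ → Submodule F X) (_ : Filt.IsFilt D.xx G) (k : ℕ)
    (_ : k + t = n) (_ : Filt.Reg D.xx G k),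
    HasProjectiveDimensionLT (ModuleCat.of R X) (t + 1) := by
  induction t with
  | zero =>
    intro X _ _ _ _ G hG k hk hr
    obtain ⟨ι, deg, f, hf, hs, hmin⟩ := D.exists_cover hG
    have hk' : k = n := hk
    subst hk'
    have hker := Filt.ker_eq_bot (Filt.freeFilt_isFilt D.isFilt_low) hs hf k hr hmin
    have hsurj : Function.Surjective f := fun m => by
      obtain ⟨d, hd⟩ := hG.exh m
      obtain ⟨q, -, hq⟩ := hs d m hd
      exact ⟨q, hq⟩
    let e := LinearEquiv.ofBijective f ⟨LinearMap.ker_eq_bot.1 hker, hsurj⟩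
    have : Module.Projective R X := Module.Projective.of_equiv e
    have : Projective (ModuleCat.of R X) := inferInstance
    rwa [projective_iff_hasProjectiveDimensionLT_one] at this
  | succ t ih =>
    intro X _ _ _ _ G hG k hk hr
    obtain ⟨ι, deg, f, hf, hs, hmin⟩ := D.exists_cover hG
    have hsurj : Function.Surjective f := fun m => by
      obtain ⟨d, hd⟩ := hG.exh m
      obtain ⟨q, -, hq⟩ := hs d m hd
      exact ⟨q, hq⟩
    have hP := Filt.freeFilt_isFilt (deg := deg) D.isFilt_low
    have hK := Filt.reg_ker hP hs hf k hr
      (Filt.reg_free D.isFilt_low (D.reg_low.mono (by omega)))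
    have h1 := ih (LinearMap.ker f) _ (Filt.kerFilt_isFilt hP) (k + 1) (by omega) hK
    have hse := ses_shortExact (A := LinearMap.ker f) (B := ι →₀ R) (C := X) (LinearMap.ker f).subtype f (Submodule.subtype_injective _) hsurj
      (LinearMap.exact_subtype_ker_map f)
    have : Projective (ModuleCat.of R (ι →₀ R)) := inferInstance
    have h2 : HasProjectiveDimensionLT (ModuleCat.of R (ι →₀ R)) (t + 1 + 1) := inferInstance
    exact hse.hasProjectiveDimensionLT_X₃ (t + 1) h1 h2

theorem gldim {F : Type u} [Field F] {R : Type u} [Ring R] [Algebra F R] {n : ℕ} (D : PData F R n) 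
    (X : ModuleCat.{u} R) : HasProjectiveDimensionLT X (n + 1) := by
  let _ : Module F X := Module.compHom X (algebraMap F R)
  have : IsScalarTower F R X := ⟨fun c r m => by
    change (c • r) • m = algebraMap F R c • r • m
    rw [Algebra.smul_def, mul_smul]⟩
  let G : ℕ → Submodule F X := fun d => if d = 0 then ⊥ else ⊤
  refine D.projDim n X G ?_ 0 (zero_add n) fun j hj => absurd hj (Nat.not_lt_zero j)
  refine D.isFilt_of (by simp [G]) ?_ (fun m => ⟨1, by simp [G]⟩) (fun i d m _ => by simp [G])
  intro d e hde
  by_cases hd : d = 0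
  · simp [G, hd]
  · have : e ≠ 0 := by omega
    simp [G, hd, this]

theorem ext_subsingleton {F : Type u} [Field F] {R : Type u} [Ring R] [Algebra F R] {n : ℕ} (D : PData F R n) 
    (X M : ModuleCat.{u} R) (m : ℕ) (hm : n < m) :
    Subsingleton (Abelian.Ext X M m) := by
  have := D.gldim X
  exact HasProjectiveDimensionLT.subsingleton X (n + 1) m hm M
end cover
end PData



namespace CenExt

variable {R : Type u} [Ring R]

theorem center_smulComm (X : Type*) [AddCommGroup X] [Module R X] :
    SMulCommClass R (Subring.center R) X where
  smul_comm r z m := by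
    change r • (z : R) • m = (z : R) • r • m
    rw [smul_smul, smul_smul, Subring.mem_center_iff.1 z.2 r]

attribute [local instance] center_smulComm

/-- The category of modules is linear over the center. -/
@[reducible] noncomputable def centerLinear (R : Type u) [Ring R] :
    Linear (Subring.center R) (ModuleCat.{u} R) where
  homModule _ _ := inferInstance
  smul_comp X Y Z r f g := by
    ext x
    exact map_smul g.hom (r : R) (f.hom x)
  comp_smul X Y Z f r g := by
    ext x
    rfl

attribute [local instance] centerLinear

/-- Multiplication by a central element. -/
noncomputable def zmap (z : Subring.center R) (X : Type u) [AddCommGroup X] [Module R X] :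
    X →ₗ[R] X := z • LinearMap.id

theorem zmap_apply (z : Subring.center R) (X : Type u) [AddCommGroup X] [Module R X] (m : X) :
    zmap z X m = (z : R) • m := rfl

theorem ext_kill (z : Subring.center R) (X M : Type u) [AddCommGroup X] [Module R X]
    [AddCommGroup M] [Module R M] (hz : ∀ m : M, (z : R) • m = 0) (n : ℕ)
    (e : Abelian.Ext (ModuleCat.of R X) (ModuleCat.of R M) n) :
    (Abelian.Ext.mk₀ (ModuleCat.ofHom (zmap z X))).comp e (zero_add n) = 0 := by
  have h1 : ModuleCat.ofHom (zmap z X) = z • 𝟙 (ModuleCat.of R X) := rfl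
  have h2 : z • 𝟙 (ModuleCat.of R M) = 0 := by
    ext m
    exact hz m
  rw [h1, Abelian.Ext.mk₀_smul, Abelian.Ext.smul_comp, Abelian.Ext.mk₀_id_comp,
    Abelian.Ext.smul_eq_comp_mk₀, h2, Abelian.Ext.mk₀_zero, Abelian.Ext.comp_zero]

/-- Dimension shifting along a central element. -/
theorem ext_step (z : Subring.center R) (X Y M : Type u) [AddCommGroup X] [Module R X]
    [AddCommGroup M] [Module R M] [AddCommGroup Y] [Module R Y]
    (hz : ∀ m : M, (z : R) • m = 0) (g : X →ₗ[R] Y)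
    (hf : Function.Injective (zmap z X)) (hg : Function.Surjective g)
    (he : Function.Exact (zmap z X) g) (n : ℕ)
    (h : Nontrivial (Abelian.Ext (ModuleCat.of R X) (ModuleCat.of R M) n)) :
    Nontrivial (Abelian.Ext (ModuleCat.of R Y) (ModuleCat.of R M) (n + 1)) := by
  have hse := PData.ses_shortExact (zmap z X) g hf hg he
  obtain ⟨e, hne⟩ := exists_ne (0 : Abelian.Ext (ModuleCat.of R X) (ModuleCat.of R M) n)
  refine ⟨⟨hse.extClass.comp e (add_comm 1 n), 0, fun h0 => ?_⟩⟩
  obtain ⟨e', he'⟩ := Abelian.Ext.contravariant_sequence_exact₁ hse _ e (add_comm 1 n) h0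
  apply hne
  rw [← he']
  exact ext_kill z X M hz n e'

end CenExt



namespace PData

section leading
variable {F : Type*} [Field F] {R : Type*} [Ring R] [Algebra F R] {n : ℕ} (D : PData F R n)

theorem lead_one : D.Lead 1 0 := by
  intro M; simp

variable {D}

theorem Lead.mul {r s : R} {A B : Multiset (Fin n)} (hr : D.Lead r A) (hs : D.Lead s B) :
    D.Lead (r * s) (A + B) := by
  intro M
  have h1 := hr.mul_mem D (hs M)
  have h2 := hr (M + B)
  rw [Multiset.card_add] at h2
  have h3 := add_mem h1 h2
  have e1 : r * (s * D.b M - D.b (M + B)) + (r * D.b (M + B) - D.b (M + B + A)) =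
      r * s * D.b M - D.b (M + (A + B)) := by
    rw [mul_sub, mul_assoc, add_assoc M B A, add_comm B A]; abel
  rw [e1] at h3
  rw [Multiset.card_add]
  exact D.low_mono (by omega) h3

theorem Lead.pow {r : R} {A : Multiset (Fin n)} (hr : D.Lead r A) (k : ℕ) :
    D.Lead (r ^ k) (k • A) := by
  induction k with
  | zero => simpa using D.lead_one
  | succ k ih => rw [pow_succ, succ_nsmul]; exact ih.mul hr

/-- `s` raises degrees by less than `k`. -/
def Low (D : PData F R n) (s : R) (k : ℕ) : Prop := ∀ M, s * D.b M ∈ D.low (M.card + k)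

theorem Lead.low {r : R} {A : Multiset (Fin n)} (hr : D.Lead r A) {k : ℕ} (hk : A.card < k) :
    D.Low r k := by
  intro M
  have := hr.mul_mem D (D.b_mem_low (Nat.lt_succ_self M.card))
  exact D.low_mono (by omega) this

theorem Low.smul {s : R} {k : ℕ} (h : D.Low s k) (c : F) : D.Low (c • s) k := by
  intro M
  rw [smul_mul_assoc]; exact Submodule.smul_mem _ _ (h M)

theorem Low.sum {ι : Type*} (t : Finset ι) {s : ι → R} {k : ℕ} (h : ∀ i ∈ t, D.Low (s i) k) :
    D.Low (∑ i ∈ t, s i) k := by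
  intro M
  rw [Finset.sum_mul]; exact Submodule.sum_mem _ fun i hi => h i hi M

theorem Lead.add_low {r s : R} {A : Multiset (Fin n)} (hr : D.Lead r A) (hs : D.Low s A.card) :
    D.Lead (r + s) A := by
  intro M
  rw [add_mul, add_sub_right_comm]
  exact add_mem (hr M) (hs M)

/-- A unitriangular family is a basis. -/
theorem exists_basis (D : PData F R n) (y : Multiset (Fin n) → R)
    (hy : ∀ M, y M - D.b M ∈ D.low M.card) :
    ∃ c : Module.Basis (Multiset (Fin n)) F R, ∀ M, c M = y M := by
  let Φ : R →ₗ[F] R := D.b.constr F y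
  have hΦb : ∀ M, Φ (D.b M) = y M := fun M => by simp [Φ]
  have key : ∀ d v, v ∈ D.low (d + 1) → Φ v - v ∈ D.low d := by
    intro d v hv
    unfold low at hv
    induction hv using Submodule.span_induction with
    | mem v hv =>
      obtain ⟨M, hM, rfl⟩ := hv
      have hM' : M.card < d + 1 := hM
      rw [hΦb]
      exact D.low_mono (by omega) (hy M)
    | zero => simp
    | add v w _ _ hv hw => rw [map_add, add_sub_add_comm]; exact add_mem hv hw
    | smul c v _ hv => rw [map_smul, ← smul_sub]; exact Submodule.smul_mem _ _ hv
  have hinj : ∀ d v, v ∈ D.low d → Φ v = 0 → v = 0 := by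
    intro d
    induction d with
    | zero => intro v hv _; rwa [low_zero, Submodule.mem_bot] at hv
    | succ d ih =>
      intro v hv h0
      have := key d v hv
      rw [h0, zero_sub] at this
      exact ih v (by simpa using this) h0
  have hsurj : ∀ d v, v ∈ D.low d → ∃ w, Φ w = v := by
    intro d
    induction d with
    | zero =>
      intro v hv
      rw [low_zero, Submodule.mem_bot] at hv
      exact ⟨0, by simp [hv]⟩
    | succ d ih =>
      intro v hv
      obtain ⟨w, hw⟩ := ih _ (key d v hv)
      exact ⟨v - w, by rw [map_sub, hw]; abel⟩
  have hbij : Function.Bijective Φ := by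
    constructor
    · rw [injective_iff_map_eq_zero]
      intro v hv
      obtain ⟨d, hd⟩ := D.exists_low v
      exact hinj d v hd hv
    · intro v
      obtain ⟨d, hd⟩ := D.exists_low v
      exact hsurj d v hd
  exact ⟨D.b.map (LinearEquiv.ofBijective Φ hbij), fun M => by
    rw [Module.Basis.map_apply]; exact hΦb M⟩

variable {w : Fin n → Subring.center R} {e : Fin n → ℕ}

/-- products of powers of the central elements -/
def cprod (w : Fin n → Subring.center R) (k : Fin n → ℕ) : Subring.center R := ∏ i, w i ^ k i

theorem lead_cprod (hw : ∀ i, D.Lead (w i : R) (Multiset.replicate (e i) i)) (k : Fin n → ℕ) :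
    D.Lead (cprod w k : R) (∑ i, k i • Multiset.replicate (e i) i) := by
  have : ∀ s : Finset (Fin n), D.Lead ((∏ i ∈ s, w i ^ k i : Subring.center R) : R)
      (∑ i ∈ s, k i • Multiset.replicate (e i) i) := by
    intro s
    induction s using Finset.induction_on with
    | empty => simpa using D.lead_one
    | insert a s ha ih =>
      rw [Finset.prod_insert ha, Finset.sum_insert ha]
      exact ((hw a).pow (k a)).mul ih
  exact this _

/-- reduced part of a multiset -/
def red (e : Fin n → ℕ) (M : Multiset (Fin n)) : Multiset (Fin n) :=
  ∑ i, Multiset.replicate (M.count i % e i) i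

theorem count_sum_replicate (f : Fin n → ℕ) (j : Fin n) :
    (∑ i, Multiset.replicate (f i) i).count j = f j := by
  rw [Multiset.count_sum']
  simp [Multiset.count_replicate]

theorem red_add (e : Fin n → ℕ) (M : Multiset (Fin n)) :
    red e M + ∑ i, (M.count i / e i) • Multiset.replicate (e i) i = M := by
  ext j
  have : ∀ i, (M.count i / e i) • Multiset.replicate (e i) i =
      Multiset.replicate (M.count i / e i * e i) i := by
    intro i
    rw [Multiset.nsmul_replicate]
  simp only [this]
  rw [Multiset.count_add, red, count_sum_replicate, count_sum_replicate]
  exact (Nat.mod_add_div' (Multiset.count j M) (e j) :)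

/-- the adapted basis -/
noncomputable def yb (D : PData F R n) (w : Fin n → Subring.center R) (e : Fin n → ℕ)
    (M : Multiset (Fin n)) : R :=
  (cprod w (fun i => M.count i / e i) : R) * D.b (red e M)

theorem yb_lead (hw : ∀ i, D.Lead (w i : R) (Multiset.replicate (e i) i))
    (M : Multiset (Fin n)) : D.yb w e M - D.b M ∈ D.low M.card := by
  have := lead_cprod hw (fun i => M.count i / e i) (red e M)
  rw [← Multiset.card_add, red_add] at this
  exact this

theorem yb_mul (he : ∀ i, 0 < e i) (k : Fin n) (M : Multiset (Fin n)) :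
    (w k : R) * D.yb w e M = D.yb w e (M + Multiset.replicate (e k) k) := by
  unfold yb
  have h1 : red e (M + Multiset.replicate (e k) k) = red e M := by
    unfold red
    refine Finset.sum_congr rfl fun i _ => ?_
    congr 1
    rw [Multiset.count_add, Multiset.count_replicate]
    split_ifs with h
    · subst h; simp
    · simp
  have h2 : (fun i => (M + Multiset.replicate (e k) k).count i / e i) =
      fun i => M.count i / e i + if i = k then 1 else 0 := by
    funext i
    rw [Multiset.count_add, Multiset.count_replicate]
    by_cases h : i = k
    · subst h; simp [Nat.add_div_right _ (he i)]
    · simp [h, Ne.symm h]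
  have h3 : cprod w (fun i => M.count i / e i + if i = k then 1 else 0) =
      w k * cprod w (fun i => M.count i / e i) := by
    unfold cprod
    simp only [pow_add, Finset.prod_mul_distrib]
    rw [mul_comm]
    congr 1
    simp
  rw [h1, h2, h3, ← mul_assoc]; rfl

/-- Data for the lower bound: a basis on which central elements act by shifts. -/
structure Shift (F R : Type*) [Field F] [Ring R] [Algebra F R] (n : ℕ)
    (w : Fin n → Subring.center R) (e : Fin n → ℕ) where
  c : Module.Basis (Multiset (Fin n)) F R
  mul : ∀ k M, (w k : R) * c M = c (M + Multiset.replicate (e k) k)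
  pos : ∀ k, 0 < e k

theorem exists_shift (D : PData F R n) (he : ∀ i, 0 < e i)
    (hw : ∀ i, D.Lead (w i : R) (Multiset.replicate (e i) i)) : Nonempty (Shift F R n w e) := by
  obtain ⟨c, hc⟩ := D.exists_basis (D.yb w e) (yb_lead hw)
  exact ⟨⟨c, fun k M => by rw [hc, hc, yb_mul he], he⟩⟩

end leading
end PData

namespace PData.Shift
variable {F : Type u} {R : Type u} [Field F] [Ring R] [Algebra F R] {n : ℕ}
    {w : Fin n → Subring.center R} {e : Fin n → ℕ} (Q : Shift F R n w e)

/-- the index set of the ideal -/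
def idx (_ : Shift F R n w e) (k : ℕ) : Set (Multiset (Fin n)) :=
  {M | ∃ i : Fin n, i.val < k ∧ e i ≤ M.count i}

/-- the ideal as a vector space -/
def J (k : ℕ) : Submodule F R := Submodule.span F (Q.c '' Q.idx k)

theorem mem_J {k : ℕ} {r : R} : r ∈ Q.J k ↔
    ∀ M, Q.c.repr r M ≠ 0 → ∃ i : Fin n, i.val < k ∧ e i ≤ M.count i := by
  unfold J
  rw [Q.c.mem_span_image]
  simp only [Set.subset_def, Finset.mem_coe, Finsupp.mem_support_iff]
  rfl

theorem repr_mul (k : Fin n) (r : R) : Q.c.repr ((w k : R) * r) =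
    (Q.c.repr r).mapDomain (· + Multiset.replicate (e k) k) := by
  have : Q.c.repr.toLinearMap ∘ₗ LinearMap.mulLeft F (w k : R) =
      Finsupp.lmapDomain F F (· + Multiset.replicate (e k) k) ∘ₗ Q.c.repr.toLinearMap := by
    refine Q.c.ext fun M => ?_
    simp [Q.mul]
  exact LinearMap.congr_fun this r

theorem repr_mul_add (k : Fin n) (r : R) (M : Multiset (Fin n)) :
    Q.c.repr ((w k : R) * r) (M + Multiset.replicate (e k) k) = Q.c.repr r M := by
  rw [repr_mul]
  exact Finsupp.mapDomain_apply (add_left_injective _) _ M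

theorem repr_mul_ne {k : Fin n} {r : R} {N : Multiset (Fin n)}
    (h : Q.c.repr ((w k : R) * r) N ≠ 0) :
    ∃ M, N = M + Multiset.replicate (e k) k ∧ Q.c.repr r M ≠ 0 := by
  have : ∃ M, M + Multiset.replicate (e k) k = N := by
    by_contra hn
    apply h
    rw [repr_mul]
    exact Finsupp.mapDomain_of_notMem_range _ _ hn
  obtain ⟨M, rfl⟩ := this
  exact ⟨M, rfl, by rwa [repr_mul_add] at h⟩

theorem w_mul_mem (i : Fin n) {k : ℕ} (hi : i.val < k) (r : R) : (w i : R) * r ∈ Q.J k := by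
  rw [mem_J]
  intro N hN
  obtain ⟨M, rfl, -⟩ := Q.repr_mul_ne hN
  exact ⟨i, hi, by simp⟩

theorem exists_sub (M : Multiset (Fin n)) (i : Fin n) (h : e i ≤ M.count i) :
    ∃ N, Q.c M = (w i : R) * Q.c N := by
  obtain ⟨N, rfl⟩ := Multiset.le_iff_exists_add.1 (Multiset.le_count_iff_replicate_le.1 h)
  exact ⟨N, by rw [Q.mul, add_comm]⟩

/-- the ideal -/
def I (k : ℕ) : Submodule R R where
  carrier := Q.J k
  add_mem' := add_mem
  zero_mem' := zero_mem _
  smul_mem' := by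
    intro a r hr
    have hr' : r ∈ Q.J k := hr
    change a * r ∈ Q.J k
    unfold J at hr'
    induction hr' using Submodule.span_induction with
    | mem v hv =>
      obtain ⟨M, ⟨i, hi, hM⟩, rfl⟩ := hv
      obtain ⟨N, hN⟩ := Q.exists_sub M i hM
      rw [hN, ← mul_assoc, Subring.mem_center_iff.1 (w i).2 a, mul_assoc]
      exact Q.w_mul_mem i hi _
    | zero => simp
    | add v w hv' hw' hv hw => rw [mul_add]; exact add_mem (hv hv') (hw hw')
    | smul c v hv' hv => rw [mul_smul_comm]; exact Submodule.smul_mem _ _ (hv hv')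

theorem mem_I {k : ℕ} {r : R} : r ∈ Q.I k ↔ r ∈ Q.J k := Iff.rfl

theorem I_zero : Q.I 0 = ⊥ := by
  rw [eq_bot_iff]
  intro r hr
  have : r ∈ Submodule.span F (Q.c '' Q.idx 0) := hr
  have h0 : Q.idx 0 = ∅ := by
    ext M; simp [idx]
  rw [h0] at this
  simpa using this

theorem I_mono (k : ℕ) : Q.I k ≤ Q.I (k + 1) := by
  intro r hr
  rw [mem_I, mem_J] at hr ⊢
  intro M hM
  obtain ⟨i, hi, h⟩ := hr M hM
  exact ⟨i, by omega, h⟩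

theorem reg {k : ℕ} (hk : k < n) {r : R} (h : (w ⟨k, hk⟩ : R) * r ∈ Q.I k) : r ∈ Q.I k := by
  rw [mem_I, mem_J] at h ⊢
  intro M hM
  rw [← Q.repr_mul_add ⟨k, hk⟩] at hM
  obtain ⟨i, hi, h'⟩ := h _ hM
  refine ⟨i, hi, ?_⟩
  have hne : ¬ (⟨k, hk⟩ : Fin n) = i := by rintro rfl; simp at hi
  rwa [Multiset.count_add, Multiset.count_replicate, if_neg hne, add_zero] at h'

theorem exists_of_mem {k : ℕ} (hk : k < n) {r : R} (h : r ∈ Q.I (k + 1)) :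
    ∃ s, r - (w ⟨k, hk⟩ : R) * s ∈ Q.I k := by
  have h' : r ∈ Submodule.span F (Q.c '' Q.idx (k + 1)) := h
  clear h
  induction h' using Submodule.span_induction with
  | mem v hv =>
    obtain ⟨M, ⟨i, hi, hM⟩, rfl⟩ := hv
    obtain ⟨N, hN⟩ := Q.exists_sub M i hM
    by_cases hik : i.val < k
    · refine ⟨0, ?_⟩
      rw [mul_zero, sub_zero, hN]
      exact Q.w_mul_mem i hik _
    · have : i = ⟨k, hk⟩ := Fin.ext (by simp; omega)
      subst this
      refine ⟨Q.c N, ?_⟩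
      rw [hN, sub_self]; exact zero_mem _
  | zero => exact ⟨0, by simp⟩
  | add v w _ _ hv hw =>
    obtain ⟨s, hs⟩ := hv
    obtain ⟨t, ht⟩ := hw
    refine ⟨s + t, ?_⟩
    rw [mul_add, add_sub_add_comm]; exact add_mem hs ht
  | smul c v _ hv =>
    obtain ⟨s, hs⟩ := hv
    refine ⟨c • s, ?_⟩
    rw [mul_smul_comm, ← smul_sub]
    exact Submodule.smul_mem (Q.J k) c hs

/-- the quotient map -/
def quo (k : ℕ) : (R ⧸ Q.I k) →ₗ[R] (R ⧸ Q.I (k + 1)) := Submodule.factor (Q.I_mono k)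

theorem ext_nontrivial (S : Type u) [AddCommGroup S] [Module R S] [Nontrivial S]
    (hS : ∀ i (m : S), (w i : R) • m = 0) (k : ℕ) (hk : k ≤ n) :
    Nontrivial (Abelian.Ext (ModuleCat.of R (R ⧸ Q.I k)) (ModuleCat.of R S) k) := by
  induction k with
  | zero =>
    obtain ⟨s, hs⟩ := exists_ne (0 : S)
    let g : (R ⧸ Q.I 0) →ₗ[R] S := Submodule.liftQ _ (LinearMap.toSpanSingleton R S s) (by
      rw [Q.I_zero]; exact bot_le)
    have hg : g (Submodule.Quotient.mk 1) = s := by simp [g]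
    refine ⟨⟨Abelian.Ext.mk₀ (ModuleCat.ofHom g), 0, fun h0 => ?_⟩⟩
    rw [Abelian.Ext.mk₀_eq_zero_iff] at h0
    apply hs
    rw [← hg]
    exact congrArg (fun q => q.hom (Submodule.Quotient.mk 1)) h0
  | succ k ih =>
    have hk' : k < n := hk
    refine CenExt.ext_step (w ⟨k, hk'⟩) (R ⧸ Q.I k) (R ⧸ Q.I (k + 1)) S (hS _) (Q.quo k) ?_ ?_ ?_ k
      (ih hk'.le)
    · rw [injective_iff_map_eq_zero]
      intro q hq
      obtain ⟨r, rfl⟩ := Submodule.Quotient.mk_surjective _ q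
      rw [CenExt.zmap_apply, ← Submodule.Quotient.mk_smul, Submodule.Quotient.mk_eq_zero] at hq
      rw [Submodule.Quotient.mk_eq_zero]
      exact Q.reg hk' hq
    · exact Submodule.factor_surjective (Q.I_mono k)
    · intro q
      obtain ⟨r, rfl⟩ := Submodule.Quotient.mk_surjective _ q
      constructor
      · intro h
        have h' : (Submodule.Quotient.mk r : R ⧸ Q.I (k + 1)) = 0 := h
        rw [Submodule.Quotient.mk_eq_zero] at h'
        obtain ⟨s, hs⟩ := Q.exists_of_mem hk' h'
        refine ⟨Submodule.Quotient.mk s, ?_⟩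
        rw [CenExt.zmap_apply, ← Submodule.Quotient.mk_smul]
        exact ((Submodule.Quotient.eq _).2 hs).symm
      · rintro ⟨q', hq'⟩
        obtain ⟨s, rfl⟩ := Submodule.Quotient.mk_surjective _ q'
        rw [← hq', CenExt.zmap_apply, ← Submodule.Quotient.mk_smul]
        change (Submodule.Quotient.mk _ : R ⧸ Q.I (k + 1)) = 0
        rw [Submodule.Quotient.mk_eq_zero]
        exact Q.w_mul_mem ⟨k, hk'⟩ (Nat.lt_succ_self k) s

end PData.Shift



namespace PData

variable {F : Type u} {R : Type u} [Field F] [Ring R] [Algebra F R] {n : ℕ}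

/-- polynomials in the central elements -/
noncomputable def phi (F : Type u) {R : Type u} [Field F] [Ring R] [Algebra F R]
    (z : Fin n → Subring.center R) : MvPolynomial (Fin n) F →ₐ[F] R :=
  (Subalgebra.center F R).val.comp
    (MvPolynomial.aeval fun i => (⟨z i, (z i).2⟩ : Subalgebra.center F R))

theorem phi_comm (z : Fin n → Subring.center R) (f : MvPolynomial (Fin n) F) :
    phi F z f ∈ Subring.center R :=
  (MvPolynomial.aeval (fun i => (⟨z i, (z i).2⟩ : Subalgebra.center F R)) f).2

theorem phi_X (z : Fin n → Subring.center R) (i : Fin n) :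
    phi F z (MvPolynomial.X i) = z i := by simp [phi]

theorem fin_reduced (e : Fin n → ℕ) :
    {N : Multiset (Fin n) | ∀ i, N.count i < e i}.Finite := by
  refine (Set.finite_Icc 0 (∑ i, Multiset.replicate (e i) i)).subset fun N hN => ?_
  refine ⟨bot_le, Multiset.le_iff_count.2 fun i => ?_⟩
  rw [count_sum_replicate]
  exact (hN i).le

theorem finite_phi {z : Fin n → Subring.center R} {e : Fin n → ℕ} (Q : Shift F R n z e)
    (S : Type u) [AddCommGroup S] [Module R S] [IsSimpleModule R S]
    [Module (MvPolynomial (Fin n) F) S] (hsm : ∀ f (m : S), f • m = phi F z f • m) :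
    Module.Finite (MvPolynomial (Fin n) F) S := by
  have := IsSimpleModule.nontrivial R S
  obtain ⟨s, hs⟩ := exists_ne (0 : S)
  let V : Submodule (MvPolynomial (Fin n) F) S :=
    Submodule.span _ ((fun N => Q.c N • s) '' {N | ∀ i, N.count i < e i})
  have h1 : ∀ d (M : Multiset (Fin n)), M.card = d → Q.c M • s ∈ V := by
    intro d
    induction d using Nat.strong_induction_on with
    | _ d ih =>
      intro M hM
      by_cases h : ∀ i, M.count i < e i
      · exact Submodule.subset_span ⟨M, h, rfl⟩
      · push Not at h
        obtain ⟨i, hi⟩ := h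
        obtain ⟨N, rfl⟩ := Multiset.le_iff_exists_add.1 (Multiset.le_count_iff_replicate_le.1 hi)
        rw [Multiset.card_add, Multiset.card_replicate] at hM
        have hp := Q.pos i
        have h2 := ih N.card (by omega) N rfl
        have h3 := V.smul_mem (MvPolynomial.X i) h2
        rwa [hsm, phi_X, smul_smul, Q.mul, add_comm] at h3
  have h2 : ∀ r : R, r • s ∈ V := by
    intro r
    have hr : r ∈ Submodule.span F (Set.range Q.c) := by rw [Q.c.span_eq]; trivial
    induction hr using Submodule.span_induction with
    | mem v hv => obtain ⟨M, rfl⟩ := hv; exact h1 _ M rfl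
    | zero => simp
    | add v w _ _ hv hw => rw [add_smul]; exact add_mem hv hw
    | smul c v _ hv =>
      have := V.smul_mem (algebraMap F _ c) hv
      rwa [hsm, AlgHom.commutes, smul_smul, ← Algebra.smul_def] at this
  have h3 : V = ⊤ := by
    rw [eq_top_iff]
    intro m _
    obtain ⟨r, rfl⟩ := IsSimpleModule.toSpanSingleton_surjective R hs m
    exact h2 r
  refine ⟨?_⟩
  rw [← h3]
  exact Submodule.fg_span ((fin_reduced e).image _)

theorem exists_ideal {z : Fin n → Subring.center R} {e : Fin n → ℕ} (Q : Shift F R n z e)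
    (S : Type u) [AddCommGroup S] [Module R S] [IsSimpleModule R S] :
    ∃ I : Ideal (MvPolynomial (Fin n) F), I.IsMaximal ∧ ∀ f ∈ I, ∀ m : S, phi F z f • m = 0 := by
  let _ : Module (MvPolynomial (Fin n) F) S := Module.compHom S (phi F z).toRingHom
  have hsm : ∀ (f : MvPolynomial (Fin n) F) (m : S), f • m = phi F z f • m := fun _ _ => rfl
  have := finite_phi Q S hsm
  have := IsSimpleModule.nontrivial R S
  obtain ⟨N, hN, -⟩ := (eq_top_or_exists_le_coatom
    (⊥ : Submodule (MvPolynomial (Fin n) F) S)).resolve_left bot_ne_top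
  have hsimp : IsSimpleModule (MvPolynomial (Fin n) F) (S ⧸ N) := isSimpleModule_iff_isCoatom.2 hN
  obtain ⟨I, hI, ⟨eq⟩⟩ := isSimpleModule_iff_quot_maximal.1 hsimp
  refine ⟨I, hI, fun f hf m => ?_⟩
  have hfN : ∀ m : S, phi F z f • m ∈ N := by
    intro m
    rw [← hsm, ← Submodule.Quotient.mk_eq_zero, Submodule.Quotient.mk_smul]
    apply eq.injective
    rw [map_smul, map_zero]
    obtain ⟨g, hg⟩ := Ideal.Quotient.mk_surjective (eq (Submodule.Quotient.mk m))
    rw [← hg]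
    change (Submodule.Quotient.mk (f • g) : _ ⧸ I) = 0
    rw [Submodule.Quotient.mk_eq_zero]
    exact I.mul_mem_right g hf
  let zf : Subring.center R := ⟨phi F z f, phi_comm z f⟩
  rcases LinearMap.surjective_or_eq_zero (CenExt.zmap zf S) with h | h
  · exfalso
    apply hN.1
    rw [eq_top_iff]
    intro m _
    obtain ⟨m', rfl⟩ := h m
    exact hfN m'
  · exact LinearMap.congr_fun h m

theorem exists_kill (D : PData F R n) (z : Fin n → Subring.center R) (e : Fin n → ℕ)
    (he : ∀ i, 0 < e i) (hz : ∀ i, D.Lead (z i : R) (Multiset.replicate (e i) i))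
    (S : Type u) [AddCommGroup S] [Module R S] [IsSimpleModule R S] :
    ∃ (w : Fin n → Subring.center R) (e' : Fin n → ℕ), (∀ i, 0 < e' i) ∧
      (∀ i, D.Lead (w i : R) (Multiset.replicate (e' i) i)) ∧
      ∀ i (m : S), (w i : R) • m = 0 := by
  obtain ⟨Q⟩ := D.exists_shift he hz
  obtain ⟨I, hI, hker⟩ := exists_ideal Q S
  let _ : Field (MvPolynomial (Fin n) F ⧸ I) := Ideal.Quotient.field I
  have hfin : Module.Finite F (MvPolynomial (Fin n) F ⧸ I) :=
    finite_of_finite_type_of_isJacobsonRing F _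
  have key : ∀ i, ∃ (w : Subring.center R) (e' : ℕ), 0 < e' ∧
      D.Lead (w : R) (Multiset.replicate e' i) ∧ ∀ m : S, (w : R) • m = 0 := by
    intro i
    let t : MvPolynomial (Fin n) F ⧸ I := Ideal.Quotient.mkₐ F I (MvPolynomial.X i)
    have hInt : IsIntegral F t := Algebra.IsIntegral.isIntegral t
    let g := minpoly F t
    have hmon : g.Monic := minpoly.monic hInt
    have hdeg : 0 < g.natDegree := minpoly.natDegree_pos hInt
    let h := Polynomial.aeval (MvPolynomial.X i : MvPolynomial (Fin n) F) g
    have hh : h ∈ I := by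
      rw [← Ideal.Quotient.eq_zero_iff_mem]
      have h1 : Polynomial.aeval t g = 0 := minpoly.aeval F t
      have h2 : Ideal.Quotient.mkₐ F I h = Polynomial.aeval t g :=
        (Polynomial.aeval_algHom_apply (Ideal.Quotient.mkₐ F I) (MvPolynomial.X i) g).symm
      rw [h1] at h2
      exact h2
    have hphi : phi F z h = Polynomial.aeval (z i : R) g := by
      have := Polynomial.aeval_algHom_apply (phi F z) (MvPolynomial.X i) g
      rw [phi_X] at this
      exact this.symm
    refine ⟨⟨phi F z h, phi_comm z h⟩, g.natDegree * e i, Nat.mul_pos hdeg (he i), ?_,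
      fun m => hker h hh m⟩
    change D.Lead (phi F z h) _
    rw [hphi, Polynomial.aeval_eq_sum_range, Finset.sum_range_succ, add_comm,
      show g.coeff g.natDegree = 1 from hmon, one_smul]
    have hpow : ∀ k, D.Lead ((z i : R) ^ k) (Multiset.replicate (k * e i) i) := by
      intro k
      have := (hz i).pow k
      rwa [Multiset.nsmul_replicate] at this
    refine (hpow _).add_low (Low.sum _ fun k hk => ((hpow k).low ?_).smul _)
    rw [Multiset.card_replicate, Multiset.card_replicate]
    exact Nat.mul_lt_mul_of_pos_right (Finset.mem_range.1 hk) (he i)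
  choose w e' h1 h2 h3 using key
  exact ⟨w, e', h1, h2, h3⟩

end PData



namespace PBW

attribute [local instance] LieRing.ofAssociativeRing

variable {F : Type u} [Field F] {L : Type u} [LieRing L] [LieAlgebra F L] {n : ℕ}

/-- The PBW data of an enveloping algebra. -/
noncomputable def pdata (b : Module.Basis (Fin n) F L) :
    PData F (UniversalEnvelopingAlgebra F L) n where
  b := pbw b
  x := fun i => UniversalEnvelopingAlgebra.ι F (b i)
  one := pbw_zero b
  lead := pbw_lead b
  comm := fun i j => by
    have h1 : UniversalEnvelopingAlgebra.ι F (b i) * UniversalEnvelopingAlgebra.ι F (b j) -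
        UniversalEnvelopingAlgebra.ι F (b j) * UniversalEnvelopingAlgebra.ι F (b i) =
        UniversalEnvelopingAlgebra.ι F ⁅b i, b j⁆ := by
      rw [LieHom.map_lie, LieRing.of_associative_ring_bracket]
    rw [h1]
    have h2 : ⁅b i, b j⁆ ∈ Submodule.span F (Set.range b) := by rw [b.span_eq]; trivial
    have h3 := Submodule.mem_map_of_mem
      (f := (UniversalEnvelopingAlgebra.ι F : L →ₗ⁅F⁆ _).toLinearMap) h2
    rw [Submodule.map_span, ← Set.range_comp] at h3
    exact h3

theorem exists_dep {V : Type*} [AddCommGroup V] [Module F V] [FiniteDimensional F V] (v : ℕ → V) :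
    ∃ (m : ℕ) (c : ℕ → F), ∑ k ∈ Finset.range m, c k • v k = v m := by
  let f : ℕ →o Submodule F V := ⟨fun m => Submodule.span F (v '' (Finset.range m)),
    fun a b hab => Submodule.span_mono (Set.image_mono (by
      intro x hx
      simp only [Finset.coe_range, Set.mem_Iio] at hx ⊢
      omega))⟩
  obtain ⟨m, hm⟩ := monotone_stabilizes_iff_noetherian.2 (inferInstance : IsNoetherian F V) f
  refine ⟨m, ?_⟩
  have h1 : v m ∈ f (m + 1) := Submodule.subset_span ⟨m, by simp, rfl⟩
  rw [← hm (m + 1) (Nat.le_succ m)] at h1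
  exact Submodule.mem_span_image_finset_iff_exists_fun' F |>.1 h1

theorem exists_central (p : ℕ) [Fact p.Prime] [CharP F p] [FiniteDimensional F L]
    (b : Module.Basis (Fin n) F L) (i : Fin n) :
    ∃ (z : Subring.center (UniversalEnvelopingAlgebra F L)) (e : ℕ), 0 < e ∧
      (pdata b).Lead (z : UniversalEnvelopingAlgebra F L) (Multiset.replicate e i) := by
  have hp : 0 < p := (Fact.out : p.Prime).pos
  obtain ⟨m, c, hc⟩ := exists_dep (F := F) (fun k => (LieAlgebra.ad F L (b i) : Module.End F L) ^ p ^ k)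
  let a := UniversalEnvelopingAlgebra.ι F (b i)
  let z := a ^ p ^ m + ∑ k ∈ Finset.range m, (-c k) • a ^ p ^ k
  have : Nontrivial (UniversalEnvelopingAlgebra F L) := by
    refine ⟨⟨pbw b 0, 0, (pbw b).ne_zero 0⟩⟩
  have : Nontrivial (Module.End F (UniversalEnvelopingAlgebra F L)) := inferInstance
  have hch : CharP (Module.End F (UniversalEnvelopingAlgebra F L)) p :=
    charP_of_injective_algebraMap (algebraMap F _).injective p
  let δ : Module.End F (UniversalEnvelopingAlgebra F L) :=
    LinearMap.mulLeft F a - LinearMap.mulRight F a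
  have hδ : ∀ k, δ ^ p ^ k = LinearMap.mulLeft F (a ^ p ^ k) - LinearMap.mulRight F (a ^ p ^ k) := by
    intro k
    rw [sub_pow_char_pow_of_commute _ _ (LinearMap.commute_mulLeft_right (R := F) a a),
      LinearMap.pow_mulLeft, LinearMap.pow_mulRight]
  have hδι : ∀ k y, (δ ^ k) (UniversalEnvelopingAlgebra.ι F y) =
      UniversalEnvelopingAlgebra.ι F (((LieAlgebra.ad F L (b i) : Module.End F L) ^ k) y) := by
    intro k y
    induction k generalizing y with
    | zero => rfl
    | succ k ih =>
      rw [pow_succ, pow_succ, Module.End.mul_apply, Module.End.mul_apply, ← ih]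
      congr 1
      rw [LieAlgebra.ad_apply, LieHom.map_lie, LieRing.of_associative_ring_bracket]
      rfl
  have hcomm1 : ∀ k y, a ^ p ^ k * UniversalEnvelopingAlgebra.ι F y -
      UniversalEnvelopingAlgebra.ι F y * a ^ p ^ k =
      UniversalEnvelopingAlgebra.ι F (((LieAlgebra.ad F L (b i) : Module.End F L) ^ p ^ k) y) := by
    intro k y
    rw [← hδι, hδ]; rfl
  have hz : ∀ y, z * UniversalEnvelopingAlgebra.ι F y - UniversalEnvelopingAlgebra.ι F y * z = 0 := by
    intro y
    have h1 : z * UniversalEnvelopingAlgebra.ι F y - UniversalEnvelopingAlgebra.ι F y * z =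
        (a ^ p ^ m * UniversalEnvelopingAlgebra.ι F y -
          UniversalEnvelopingAlgebra.ι F y * a ^ p ^ m) +
        ∑ k ∈ Finset.range m, (-c k) • (a ^ p ^ k * UniversalEnvelopingAlgebra.ι F y -
          UniversalEnvelopingAlgebra.ι F y * a ^ p ^ k) := by
      simp only [z, add_mul, mul_add, Finset.sum_mul, Finset.mul_sum, smul_sub,
        Finset.sum_sub_distrib, smul_mul_assoc, mul_smul_comm]
      abel
    rw [h1, hcomm1, ← hc]
    simp only [hcomm1, LinearMap.sum_apply, LinearMap.smul_apply]
    rw [← LieHom.coe_toLinearMap, map_sum, ← Finset.sum_add_distrib]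
    refine Finset.sum_eq_zero fun k _ => ?_
    rw [map_smul, neg_smul, add_neg_cancel]
  have hcen : z ∈ Subring.center (UniversalEnvelopingAlgebra F L) := by
    have htop := U_adjoin (Subalgebra.centralizer F {z}) (fun y => by
      rw [Subalgebra.mem_centralizer_iff]
      rintro g rfl
      exact sub_eq_zero.1 (hz y))
    rw [Subring.mem_center_iff]
    intro g
    have hg : g ∈ Subalgebra.centralizer F {z} := by rw [htop]; trivial
    rw [Subalgebra.mem_centralizer_iff] at hg
    exact (hg z rfl).symm
  have hpow : ∀ k, (pdata b).Lead (a ^ k) (Multiset.replicate k i) := by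
    intro k
    have := ((pdata b).lead_x i).pow k
    rwa [Multiset.nsmul_singleton] at this
  refine ⟨⟨z, hcen⟩, p ^ m, pow_pos hp m, ?_⟩
  refine (hpow _).add_low (PData.Low.sum _ fun k hk => ((hpow _).low ?_).smul _)
  rw [Multiset.card_replicate, Multiset.card_replicate]
  exact Nat.pow_lt_pow_right (Fact.out : p.Prime).one_lt (Finset.mem_range.1 hk)

end PBW

/-- Over a field of prime characteristic, every simple module over the
universal enveloping algebra of a finite-dimensional Lie algebra `𝔞` has injective
dimension exactly `dim_F 𝔞`. -/
theorem injective_dimension_of_simple_module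
    (F : Type u) [Field F] (p : ℕ) [Fact p.Prime] [CharP F p]
    (L : Type u) [LieRing L] [LieAlgebra F L] [FiniteDimensional F L]
    (S : Type u) [AddCommGroup S] [Module (UniversalEnvelopingAlgebra F L) S]
    [IsSimpleModule (UniversalEnvelopingAlgebra F L) S] :
    InjDimEq F (UniversalEnvelopingAlgebra F L)
      (ModuleCat.of (UniversalEnvelopingAlgebra F L) S) (Module.finrank F L) := by
  have b := Module.finBasis F L
  choose z e he hz using PBW.exists_central p b
  obtain ⟨w, e', he', hw, hS⟩ := (PBW.pdata b).exists_kill z e he hz S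
  obtain ⟨Q⟩ := (PBW.pdata b).exists_shift he' hw
  have := IsSimpleModule.nontrivial (UniversalEnvelopingAlgebra F L) S
  refine ⟨fun X m hm => ?_, ⟨ModuleCat.of _ (UniversalEnvelopingAlgebra F L ⧸ Q.I _),
    extGrp_nontrivial F _ _ _ _ (Q.ext_nontrivial S hS _ le_rfl)⟩⟩
  obtain ⟨m, rfl⟩ : ∃ k, m = k + 1 := ⟨m - 1, by omega⟩
  exact (extGrp_subsingleton_iff F _ _ _ _).2 ((PBW.pdata b).ext_subsingleton X _ _ hm)
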